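/- arXiv:1306.4524 — 2 statements merged into one kernel-verified Lean document; each statement's English description precedes it below -/
import Mathlib

section
/- Let ω : ℕ^d → [0,∞) be supported on the box [1,N] = Π{n ≤ N_i}, f : [1,N] → ℂ arbitrary, and suppose ω = Σ_{j∈J} ω_j is a finite decomposition with ω_j : [1,N] → ℂ. Let W_f(α) = Σ_n f(n)ω(n)e(α·n) and W_j(α) = Σ_n ω_j(n)e(α·n). Then for every p > 2, (∫_{T^d} |W_f(α)|^p dα)^{1/p} ≤ (Σ_n |f(n)|² ω(n))^{1/2} · (Σ_{j∈J} ‖W_j‖_p^{(p−2)/p} ‖ω_j‖_{2p/(p−2)}^{2/p})^{1/2}, where ‖W_j‖_p is the L^p norm on the torus T^d and ‖ω_j‖_r = (Σ_n |ω_j(n)|^r)^{1/r}. -/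
open Finset Complex MeasureTheory

namespace HYaux

set_option linter.unusedSectionVars false

section general

variable {X : Type*} [TopologicalSpace X] [CompactSpace X] [MeasurableSpace X] [BorelSpace X]

lemma cint {E : Type*} [NormedAddCommGroup E] [SecondCountableTopology E] (μ : Measure X)
    [IsProbabilityMeasure μ] {g : X → E} (hg : Continuous g) : Integrable g μ :=
  memLp_one_iff_integrable.1
    (hg.memLp_of_hasCompactSupport (HasCompactSupport.of_compactSpace g))

lemma holder (μ : Measure X) [IsProbabilityMeasure μ] {p q : ℝ} (hpq : p.HolderConjugate q)
    {u v : X → ℂ} (hu : Continuous u) (hv : Continuous v) :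
    ‖∫ x, u x * v x ∂μ‖ ≤ (∫ x, ‖u x‖ ^ p ∂μ) ^ (1 / p) * (∫ x, ‖v x‖ ^ q ∂μ) ^ (1 / q) := by
  refine (norm_integral_le_integral_norm _).trans ?_
  simp only [norm_mul]
  exact integral_mul_norm_le_Lp_mul_Lq hpq
    (hu.memLp_of_hasCompactSupport (HasCompactSupport.of_compactSpace u))
    (hv.memLp_of_hasCompactSupport (HasCompactSupport.of_compactSpace v))

variable {κ : Type*} [DecidableEq κ]

lemma parseval (μ : Measure X) [IsProbabilityMeasure μ] (e : κ → X → ℂ)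
    (he : ∀ n, Continuous (e n))
    (ho : ∀ m n, ∫ x, e m x * (starRingEnd ℂ) (e n x) ∂μ = if m = n then 1 else 0)
    (S : Finset κ) (a : κ → ℂ) :
    ∫ x, ‖∑ n ∈ S, a n * e n x‖ ^ 2 ∂μ = ∑ n ∈ S, ‖a n‖ ^ 2 := by
  have h : ((∫ x, ‖∑ n ∈ S, a n * e n x‖ ^ 2 ∂μ : ℝ) : ℂ) = ((∑ n ∈ S, ‖a n‖ ^ 2 : ℝ) : ℂ) := by
    rw [← integral_complex_ofReal]
    have : ∀ x, ((‖∑ n ∈ S, a n * e n x‖ ^ 2 : ℝ) : ℂ) =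
        ∑ m ∈ S, ∑ n ∈ S, (a m * (starRingEnd ℂ) (a n)) *
          (e m x * (starRingEnd ℂ) (e n x)) := by
      intro x
      push_cast
      rw [← Complex.mul_conj', map_sum, Finset.sum_mul_sum]
      refine Finset.sum_congr rfl fun m _ => Finset.sum_congr rfl fun n _ => ?_
      rw [map_mul]; ring
    simp_rw [this]
    have hc : ∀ m n, Continuous fun x => (a m * (starRingEnd ℂ) (a n)) *
          (e m x * (starRingEnd ℂ) (e n x)) := fun m n =>
      continuous_const.mul ((he m).mul (Complex.continuous_conj.comp (he n)))
    rw [integral_finsetSum _ fun m _ => cint μ (continuous_finsetSum _ fun n _ => hc m n)]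
    push_cast
    refine Finset.sum_congr rfl fun m hm => ?_
    rw [integral_finsetSum _ fun n _ => cint μ (hc m n)]
    simp_rw [integral_const_mul, ho]
    simp [hm, Complex.mul_conj']
  exact_mod_cast h

lemma cs (μ : Measure X) [IsProbabilityMeasure μ] 
    {u v : X → ℂ} (hu : Continuous u) (hv : Continuous v) :
    ‖∫ x, u x * v x ∂μ‖ ≤ Real.sqrt (∫ x, ‖u x‖ ^ 2 ∂μ) * Real.sqrt (∫ x, ‖v x‖ ^ 2 ∂μ) := by
  have := holder μ Real.HolderConjugate.two_two hu hv
  simpa [Real.sqrt_eq_rpow] using this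

lemma sum_int (μ : Measure X) [IsProbabilityMeasure μ] (e : κ → X → ℂ)
    (he : ∀ n, Continuous (e n)) (S : Finset κ) (b : κ → ℂ) {g : X → ℂ} (hg : Continuous g) :
    ∑ n ∈ S, b n * ∫ x, g x * e n x ∂μ = ∫ x, g x * ∑ n ∈ S, b n * e n x ∂μ := by
  simp_rw [← integral_const_mul, Finset.mul_sum]
  rw [integral_finsetSum]
  · refine Finset.sum_congr rfl fun n _ => integral_congr_ae (Filter.Eventually.of_forall fun x => ?_)
    simp only; ring
  · intro n _
    have := he n
    exact cint μ (by fun_prop)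

/-- the `L²` endpoint -/
lemma endpoint_two (μ : Measure X) [IsProbabilityMeasure μ] (e : κ → X → ℂ)
    (he : ∀ n, Continuous (e n))
    (ho : ∀ m n, ∫ x, e m x * (starRingEnd ℂ) (e n x) ∂μ = if m = n then 1 else 0)
    (S : Finset κ) (b : κ → ℂ) {g : X → ℂ} (hg : Continuous g) :
    ‖∑ n ∈ S, b n * ∫ x, g x * e n x ∂μ‖ ≤
      Real.sqrt (∑ n ∈ S, ‖b n‖ ^ 2) * Real.sqrt (∫ x, ‖g x‖ ^ 2 ∂μ) := by
  rw [sum_int μ e he S b hg, mul_comm, ← parseval μ e he ho]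
  exact cs μ hg (continuous_finsetSum _ fun n _ => continuous_const.mul (he n))

lemma endpoint_one (μ : Measure X) [IsProbabilityMeasure μ] (e : κ → X → ℂ)
    (he1 : ∀ n x, ‖e n x‖ = 1)
    (S : Finset κ) (b : κ → ℂ) {g : X → ℂ} :
    ‖∑ n ∈ S, b n * ∫ x, g x * e n x ∂μ‖ ≤
      (∑ n ∈ S, ‖b n‖) * (∫ x, ‖g x‖ ∂μ) := by
  refine (norm_sum_le _ _).trans ?_
  rw [Finset.sum_mul]
  refine Finset.sum_le_sum fun n _ => ?_
  rw [norm_mul]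
  refine mul_le_mul_of_nonneg_left ?_ (norm_nonneg _)
  refine (norm_integral_le_integral_norm _).trans (le_of_eq ?_)
  simp [he1]

/-- holomorphy of the parametric integral -/
lemma holo (μ : Measure X) [IsProbabilityMeasure μ] {v : X → ℂ} {L : X → ℝ}
    (hv : Continuous v) (hL : Continuous L) (z : ℂ) :
    DifferentiableAt ℂ (fun z : ℂ => ∫ x, Complex.exp (z * L x) * v x ∂μ) z := by
  obtain ⟨B, hB⟩ := (isCompact_range hL).isBounded.exists_norm_le
  have hB' : ∀ x, |L x| ≤ B := fun x => hB _ ⟨x, rfl⟩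
  have hm : ∀ z : ℂ, Continuous fun x => Complex.exp (z * L x) * v x := fun z => by fun_prop
  have hm' : ∀ z : ℂ, Continuous fun x => Complex.exp (z * L x) * L x * v x := 
    fun z => by fun_prop
  refine (hasDerivAt_integral_of_dominated_loc_of_deriv_le (𝕜 := ℂ) (μ := μ) 
    (F := fun z x => Complex.exp (z * L x) * v x) (x₀ := z)
    (F' := fun z x => Complex.exp (z * L x) * L x * v x) 
    (bound := fun x => Real.exp ((‖z‖ + 1) * B) * B * ‖v x‖) (Metric.ball_mem_nhds z one_pos)
    (Filter.Eventually.of_forall fun z => (hm z).aestronglyMeasurable)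
    (cint μ (hm z)) (hm' z).aestronglyMeasurable
    (Filter.Eventually.of_forall ?_) (cint μ (by fun_prop))
    (Filter.Eventually.of_forall ?_)).2.differentiableAt
  · intro x w hw
    have hB0 : 0 ≤ B := (abs_nonneg _).trans (hB' x)
    rw [norm_mul, norm_mul, Complex.norm_exp, Complex.norm_real, Real.norm_eq_abs]
    gcongr
    · have h1 : (w * L x).re ≤ ‖w * L x‖ := Complex.re_le_norm _
      rw [norm_mul, Complex.norm_real, Real.norm_eq_abs] at h1
      refine h1.trans (mul_le_mul ?_ (hB' x) (abs_nonneg _) (by positivity))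
      have : ‖w - z‖ < 1 := by simpa [dist_eq_norm] using hw
      have h2 := norm_add_le (w - z) z
      simp only [sub_add_cancel] at h2
      linarith
    · exact hB' x
  · intro x w _
    have : HasDerivAt (fun z : ℂ => z * L x) (L x : ℂ) w := by
      simpa using (hasDerivAt_id w).mul_const (L x : ℂ)
    exact this.cexp.mul_const _




lemma norm_exp_aux (q l : ℝ) (z : ℂ) :
    ‖Complex.exp ((q * (1 - z / 2)) * l)‖ = Real.exp (q * (1 - z.re / 2) * l) := by
  rw [Complex.norm_exp]
  congr 1
  have : ((q * (1 - z / 2)) * l : ℂ) = ((q * l : ℝ) : ℂ) * (1 - z / 2) := by push_cast; ring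
  rw [this, Complex.re_ofReal_mul]
  simp
  ring

lemma hy_core (μ : Measure X) [IsProbabilityMeasure μ] (e : κ → X → ℂ)
    (he : ∀ n, Continuous (e n)) (he1 : ∀ n x, ‖e n x‖ = 1)
    (ho : ∀ m n, ∫ x, e m x * (starRingEnd ℂ) (e n x) ∂μ = if m = n then 1 else 0)
    (S : Finset κ) (q : ℝ) (hq1 : 1 < q) (hq2 : q < 2)
    (a : κ → ℝ) (ha : ∀ n ∈ S, 0 < a n) (b : κ → ℂ) (hb : ∀ n, ‖b n‖ ≤ 1)
    {u : X → ℂ} {ρ : X → ℝ} (hu : Continuous u) (hu1 : ∀ x, ‖u x‖ ≤ 1)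
    (hρ : Continuous ρ) (hρ0 : ∀ x, 0 < ρ x) :
    ‖∑ n ∈ S, (b n * a n) * ∫ x, (u x * ρ x) * e n x ∂μ‖ ≤
      (∑ n ∈ S, a n ^ q) ^ (1 / q) * (∫ x, ρ x ^ q ∂μ) ^ (1 / q) := by
  have hq0 : 0 < q := by linarith
  obtain ⟨L, hLdef⟩ : ∃ L : X → ℝ, L = fun x => Real.log (ρ x) := ⟨_, rfl⟩
  have hL : Continuous L := by rw [hLdef]; exact hρ.log fun x => (hρ0 x).ne'
  have hLexp : ∀ t x, Real.exp (t * L x) = ρ x ^ t := fun t x => by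
    rw [hLdef, Real.rpow_def_of_pos (hρ0 x), mul_comm]
  have haexp : ∀ t, ∀ n ∈ S, Real.exp (t * Real.log (a n)) = a n ^ t := fun t n hn => by
    rw [Real.rpow_def_of_pos (ha n hn), mul_comm]
  set A := ∑ n ∈ S, a n ^ q with hA
  set R := ∫ x, ρ x ^ q ∂μ with hR
  have hA0 : 0 ≤ A := Finset.sum_nonneg fun n hn => Real.rpow_nonneg (ha n hn).le _
  have hR0 : 0 ≤ R := integral_nonneg fun x => Real.rpow_nonneg (hρ0 x).le _
  let β : ℂ → κ → ℂ := fun z n => b n * Complex.exp ((q * (1 - z / 2)) * Real.log (a n))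
  let G : ℂ → X → ℂ := fun z x => u x * Complex.exp ((q * (1 - z / 2)) * L x)
  let F : ℂ → ℂ := fun z => ∑ n ∈ S, β z n * ∫ x, G z x * e n x ∂μ
  have hGc : ∀ z, Continuous (G z) := fun z => by simp only [G]; fun_prop
  have hβn : ∀ z n, ‖β z n‖ ≤ Real.exp (q * (1 - z.re / 2) * Real.log (a n)) := fun z n => by
    simp only [β]
    rw [norm_mul, norm_exp_aux]
    exact mul_le_of_le_one_left (Real.exp_pos _).le (hb n)
  have hGn : ∀ z x, ‖G z x‖ ≤ Real.exp (q * (1 - z.re / 2) * L x) := fun z x => by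
    simp only [G]
    rw [norm_mul, norm_exp_aux]
    exact mul_le_of_le_one_left (Real.exp_pos _).le (hu1 x)
  have hF1 : ∀ z, ‖F z‖ ≤ (∑ n ∈ S, Real.exp (q * (1 - z.re / 2) * Real.log (a n))) *
      ∫ x, Real.exp (q * (1 - z.re / 2) * L x) ∂μ := fun z => by
    refine (endpoint_one μ e he1 S (β z) (g := G z)).trans ?_
    refine mul_le_mul (Finset.sum_le_sum fun n _ => hβn z n) ?_
      (integral_nonneg fun x => norm_nonneg _) (Finset.sum_nonneg fun n _ => (Real.exp_pos _).le)
    exact integral_mono (cint μ (hGc z).norm) (cint μ (by fun_prop)) (hGn z)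
  have hdiff : Differentiable ℂ F := by
    intro z
    refine DifferentiableAt.fun_sum fun n _ => ?_
    refine DifferentiableAt.mul ?_ ?_
    · simp only [β]; fun_prop
    · have h1 := holo μ (v := fun x => u x * e n x) (L := L) (hu.mul (he n)) hL (q * (1 - z / 2))
      have h2 : DifferentiableAt ℂ (fun z : ℂ => (q * (1 - z / 2) : ℂ)) z := by fun_prop
      have h3 := h1.comp z h2
      refine h3.congr_of_eventuallyEq (Filter.Eventually.of_forall fun w => ?_)
      simp only [Function.comp, G]
      refine integral_congr_ae (Filter.Eventually.of_forall fun x => ?_)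
      simp only; ring
  have hzero : ∀ z ∈ re ⁻¹' {(0:ℝ)}, ‖F z‖ ≤ A * R := by
    intro z hz
    have hz' : z.re = 0 := hz
    refine (hF1 z).trans (le_of_eq ?_)
    rw [hz', hA, hR]
    congr 1
    · refine Finset.sum_congr rfl fun n hn => ?_
      rw [haexp _ n hn]; simp
    · simp only [hLexp]; simp
  have hone : ∀ z ∈ re ⁻¹' {(1:ℝ)}, ‖F z‖ ≤ Real.sqrt A * Real.sqrt R := by
    intro z hz
    have hz' : z.re = 1 := hz
    refine (endpoint_two μ e he ho S (β z) (hGc z)).trans ?_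
    gcongr
    · refine Finset.sum_le_sum fun n hn => ?_
      refine (pow_le_pow_left₀ (norm_nonneg _) (hβn z n) 2).trans (le_of_eq ?_)
      rw [hz', ← haexp q n hn, ← Real.exp_nat_mul]
      congr 1; push_cast; ring
    · refine integral_mono (cint μ ((hGc z).norm.pow 2)) (cint μ ?_) fun x => ?_
      · simp only [← hLexp]; fun_prop
      refine (pow_le_pow_left₀ (norm_nonneg _) (hGn z x) 2).trans (le_of_eq ?_)
      rw [hz', ← hLexp q x, ← Real.exp_nat_mul]
      congr 1; push_cast; ring
  have hbdd : BddAbove ((norm ∘ F) '' Complex.HadamardThreeLines.verticalClosedStrip 0 1) := by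
    refine ⟨(∑ n ∈ S, Real.exp (q * |Real.log (a n)|)) * ∫ x, Real.exp (q * |L x|) ∂μ, ?_⟩
    rintro _ ⟨z, hz, rfl⟩
    have hz' : z.re ∈ Set.Icc (0:ℝ) 1 := hz
    have key : ∀ l : ℝ, q * (1 - z.re / 2) * l ≤ q * |l| := fun l => by
      rw [mul_assoc]
      refine mul_le_mul_of_nonneg_left ?_ hq0.le
      have h1 : 0 ≤ 1 - z.re / 2 := by linarith [hz'.2]
      calc (1 - z.re / 2) * l ≤ (1 - z.re / 2) * |l| :=
            mul_le_mul_of_nonneg_left (le_abs_self l) h1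
        _ ≤ 1 * |l| := mul_le_mul_of_nonneg_right (by linarith [hz'.1]) (abs_nonneg _)
        _ = |l| := one_mul _
    refine (hF1 z).trans ?_
    refine mul_le_mul (Finset.sum_le_sum fun n _ => Real.exp_le_exp.2 (key _)) ?_
      (integral_nonneg fun x => (Real.exp_pos _).le)
      (Finset.sum_nonneg fun n _ => (Real.exp_pos _).le)
    exact integral_mono (cint μ (by fun_prop)) (cint μ (by fun_prop))
      fun x => Real.exp_le_exp.2 (key _)
  have hq1' : 1 / q < 1 := by rw [div_lt_one hq0]; exact hq1
  have hq2' : 1 / 2 < 1 / q := one_div_lt_one_div_of_lt hq0 hq2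
  have hθ : (((2 - 2 * (1 / q) : ℝ) : ℂ)) ∈ Complex.HadamardThreeLines.verticalClosedStrip 0 1 := by
    change (((2 - 2 * (1 / q) : ℝ) : ℂ)).re ∈ Set.Icc (0:ℝ) 1
    rw [Complex.ofReal_re]
    constructor <;> linarith
  have main := Complex.HadamardThreeLines.norm_le_interp_of_mem_verticalClosedStrip₀₁' F hθ
    hdiff.diffContOnCl hbdd hzero hone
  rw [Complex.ofReal_re] at main
  have hexpo : (q * (1 - ((2 - 2 * (1 / q) : ℝ) : ℂ) / 2) : ℂ) = 1 := by
    have : (q : ℂ) ≠ 0 := by exact_mod_cast hq0.ne'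
    push_cast
    field_simp
    ring
  have hFθ : F ((2 - 2 * (1 / q) : ℝ) : ℂ) = ∑ n ∈ S, (b n * a n) * ∫ x, (u x * ρ x) * e n x ∂μ := by
    simp only [F, β, G, hexpo, one_mul]
    refine Finset.sum_congr rfl fun n hn => ?_
    congr 2
    · rw [← Complex.ofReal_exp, Real.exp_log (ha n hn)]
    · ext x
      have := hLexp 1 x
      rw [one_mul, Real.rpow_one] at this
      rw [← Complex.ofReal_exp, this]
  rw [hFθ] at main
  refine main.trans (le_of_eq ?_)
  have hcomb : ∀ t : ℝ, 0 ≤ t → t ^ (1 - (2 - 2 * (1 / q))) * (Real.sqrt t) ^ (2 - 2 * (1 / q)) =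
      t ^ (1 / q) := fun t ht => by
    rw [Real.sqrt_eq_rpow, ← Real.rpow_mul ht, ← Real.rpow_add_of_nonneg ht (by linarith)
      (by linarith)]
    congr 1; ring
  rw [Real.mul_rpow hA0 hR0, Real.mul_rpow (Real.sqrt_nonneg _) (Real.sqrt_nonneg _),
    ← hcomb A hA0, ← hcomb R hR0]
  ring

/-- Hausdorff–Young -/
lemma hy (μ : Measure X) [IsProbabilityMeasure μ] (e : κ → X → ℂ)
    (he : ∀ n, Continuous (e n)) (he1 : ∀ n x, ‖e n x‖ = 1)
    (ho : ∀ m n, ∫ x, e m x * (starRingEnd ℂ) (e n x) ∂μ = if m = n then 1 else 0)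
    (S : Finset κ) {p q : ℝ} (hp : 2 < p) (hpq : p.HolderConjugate q)
    {g : X → ℂ} (hg : Continuous g) :
    (∑ n ∈ S, ‖∫ x, g x * e n x ∂μ‖ ^ p) ^ (1 / p) ≤ (∫ x, ‖g x‖ ^ q ∂μ) ^ (1 / q) := by
  have hp0 : 0 < p := hpq.pos
  have hq0 : 0 < q := hpq.symm.pos
  have hq1 : 1 < q := hpq.symm.lt
  have hinv : 1 / p + 1 / q = 1 := by simpa using hpq.inv_add_inv_eq_one
  have hq2 : q < 2 := by
    have h1 : 1 / p < 1 / 2 := one_div_lt_one_div_of_lt (by norm_num) hp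
    have h2 : 1 / 2 < 1 / q := by linarith
    exact lt_of_one_div_lt_one_div two_pos h2
  set c : κ → ℂ := fun n => ∫ x, g x * e n x ∂μ with hc
  -- bound with epsilon
  have heps : ∀ ε : ℝ, 0 < ε → (∑ n ∈ S, ‖c n‖ ^ p) ≤ 
      (∑ n ∈ S, ‖c n‖ ^ p) ^ (1 / q) * (∫ x, (‖g x‖ + ε) ^ q ∂μ) ^ (1 / q) := by
    intro ε hε
    have hpos : ∀ x, 0 < ‖g x‖ + ε := fun x => by positivity
    have hne : ∀ x, ((‖g x‖ + ε : ℝ) : ℂ) ≠ 0 := fun x => by exact_mod_cast (hpos x).ne'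
    have hρ : Continuous fun x => ‖g x‖ + ε := by fun_prop
    have h := hy_core μ e he he1 ho (S.filter fun n => c n ≠ 0) q hq1 hq2
      (fun n => ‖c n‖ ^ (p - 1)) (fun n hn => Real.rpow_pos_of_pos (norm_pos_iff.2
        (Finset.mem_filter.1 hn).2) _)
      (fun n => (starRingEnd ℂ) (c n) / ‖c n‖) (fun n => by
        rw [norm_div, RCLike.norm_conj, Complex.norm_real, norm_norm]; exact div_self_le_one _)
      (u := fun x => g x / ((‖g x‖ + ε : ℝ) : ℂ)) (ρ := fun x => ‖g x‖ + ε)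
      (hg.div (Complex.continuous_ofReal.comp hρ) hne)
      (fun x => by
        rw [norm_div, Complex.norm_real, Real.norm_of_nonneg (hpos x).le, div_le_one (hpos x)]
        linarith) hρ hpos
    have e1 : ∀ x, g x / ((‖g x‖ + ε : ℝ) : ℂ) * ((‖g x‖ + ε : ℝ) : ℂ) = g x := fun x =>
      div_mul_cancel₀ _ (hne x)
    simp only [e1] at h
    have e2 : ∑ n ∈ S.filter (fun n => c n ≠ 0), (‖c n‖ ^ (p - 1)) ^ q = ∑ n ∈ S, ‖c n‖ ^ p := by
      rw [Finset.sum_filter]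
      refine Finset.sum_congr rfl fun n _ => ?_
      split_ifs with h0
      · rw [← Real.rpow_mul (norm_nonneg _), hpq.sub_one_mul_conj]
      · simp only [ne_eq, not_not] at h0
        rw [h0, norm_zero, Real.zero_rpow hp0.ne']
    have e3 : ∑ n ∈ S.filter (fun n => c n ≠ 0), (starRingEnd ℂ) (c n) / ‖c n‖ *
        ((‖c n‖ ^ (p - 1) : ℝ) : ℂ) * (∫ x, g x * e n x ∂μ) = ((∑ n ∈ S, ‖c n‖ ^ p : ℝ) : ℂ) := by
      rw [Finset.sum_filter]
      push_cast
      refine Finset.sum_congr rfl fun n _ => ?_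
      split_ifs with h0
      · change (starRingEnd ℂ) (c n) / ‖c n‖ * ((‖c n‖ ^ (p - 1) : ℝ) : ℂ) * c n = _
        have hn : 0 < ‖c n‖ := norm_pos_iff.2 h0
        have hn' : (‖c n‖ : ℂ) ≠ 0 := by exact_mod_cast hn.ne'
        have : (starRingEnd ℂ) (c n) / ‖c n‖ * ((‖c n‖ ^ (p - 1) : ℝ) : ℂ) * c n =
          (c n * (starRingEnd ℂ) (c n)) / ‖c n‖ * ((‖c n‖ ^ (p - 1) : ℝ) : ℂ) := by ring
        rw [this, Complex.mul_conj', Real.rpow_sub_one hn.ne']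
        push_cast
        field_simp
      · simp only [ne_eq, not_not] at h0
        rw [h0, norm_zero, Real.zero_rpow hp0.ne', Complex.ofReal_zero]
    rw [e2, e3, Complex.norm_real, Real.norm_of_nonneg
      (Finset.sum_nonneg fun n _ => Real.rpow_nonneg (norm_nonneg _) _)] at h
    exact h
  set C := ∑ n ∈ S, ‖c n‖ ^ p with hC
  have hC0 : 0 ≤ C := Finset.sum_nonneg fun n _ => Real.rpow_nonneg (norm_nonneg _) _
  rcases hC0.eq_or_lt with h0 | hCpos
  · rw [← h0, Real.zero_rpow (by positivity)]
    exact Real.rpow_nonneg (integral_nonneg fun x => Real.rpow_nonneg (norm_nonneg _) _) _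
  have heps' : ∀ ε : ℝ, 0 < ε → C ^ (1 / p) ≤ (∫ x, (‖g x‖ + |ε|) ^ q ∂μ) ^ (1 / q) := by
    intro ε hε
    have h := heps ε hε
    rw [abs_of_pos hε]
    have : C = C ^ (1 / q) * C ^ (1 / p) := by
      rw [← Real.rpow_add hCpos, add_comm, hinv, Real.rpow_one]
    rw [this] at h
    have h1 : 0 < C ^ (1 / q) := Real.rpow_pos_of_pos hCpos _
    rw [← this] at h
    refine le_of_mul_le_mul_left ?_ h1
    rwa [← this]
  have hcont : Continuous fun ε : ℝ => (∫ x, (‖g x‖ + |ε|) ^ q ∂μ) ^ (1 / q) := by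
    refine Continuous.rpow_const ?_ fun _ => Or.inr (by positivity)
    have := continuous_parametric_integral_of_continuous (μ := μ) 
      (f := fun (ε : ℝ) x => (‖g x‖ + |ε|) ^ q) (s := Set.univ) (by
        refine Continuous.rpow_const ?_ fun _ => Or.inr hq0.le
        fun_prop) isCompact_univ
    simpa using this
  have hlim := (hcont.tendsto 0).mono_left (nhdsWithin_le_nhds (s := Set.Ioi 0))
  simp only [abs_zero, add_zero] at hlim
  exact ge_of_tendsto hlim (eventually_nhdsWithin_of_forall fun ε hε => heps' ε hε)
lemma perj [AddCommGroup X] [IsTopologicalAddGroup X] (μ : Measure X) [IsProbabilityMeasure μ]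
    [μ.IsAddRightInvariant] (e : κ → X → ℂ)
    (he : ∀ n, Continuous (e n)) (he1 : ∀ n x, ‖e n x‖ = 1)
    (ho : ∀ m n, ∫ x, e m x * (starRingEnd ℂ) (e n x) ∂μ = if m = n then 1 else 0)
    (hes : ∀ n x y, e n (y - x) = e n y * (starRingEnd ℂ) (e n x))
    (S : Finset κ) {p q : ℝ} (hp : 2 < p) (hpq : p.HolderConjugate q)
    {g : X → ℂ} (hg : Continuous g) (w : κ → ℂ) :
    ‖∑ n ∈ S, w n * ((‖∫ x, g x * e n x ∂μ‖ ^ 2 : ℝ) : ℂ)‖ ≤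
      ((∫ x, ‖g x‖ ^ q ∂μ) ^ (1 / q)) ^ 2 *
      (((∫ x, ‖∑ n ∈ S, w n * e n x‖ ^ p ∂μ) ^ (1 / p)) ^ ((p - 2) / p) *
        ((∑ n ∈ S, ‖w n‖ ^ (2 * p / (p - 2))) ^ ((p - 2) / (2 * p))) ^ (2 / p)) := by
  have hp0 : 0 < p := hpq.pos
  have hp2 : 0 < p - 2 := by linarith
  have hhy := hy μ e he he1 ho S hp hpq hg
  set G := (∫ x, ‖g x‖ ^ q ∂μ) ^ (1 / q) with hG
  set Wp := (∫ x, ‖∑ n ∈ S, w n * e n x‖ ^ p ∂μ) ^ (1 / p) with hWp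
  set Ω := (∑ n ∈ S, ‖w n‖ ^ (2 * p / (p - 2))) ^ ((p - 2) / (2 * p)) with hΩ
  set c : κ → ℂ := fun n => ∫ x, g x * e n x ∂μ with hc
  have hG0 : 0 ≤ G := Real.rpow_nonneg (integral_nonneg fun x => Real.rpow_nonneg (norm_nonneg _) _) _
  have hW0 : 0 ≤ Wp := Real.rpow_nonneg (integral_nonneg fun x => Real.rpow_nonneg (norm_nonneg _) _) _
  have hΩ0 : 0 ≤ Ω := Real.rpow_nonneg (Finset.sum_nonneg fun x _ => Real.rpow_nonneg (norm_nonneg _) _) _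
  have hce : ∀ n, Continuous fun x => (starRingEnd ℂ) (e n x) := fun n =>
    Complex.continuous_conj.comp (he n)
  have hcg : Continuous fun x => (starRingEnd ℂ) (g x) := Complex.continuous_conj.comp hg
  set K : X → ℂ := fun x => ∑ n ∈ S, (w n * c n) * (starRingEnd ℂ) (e n x) with hK
  have hKc : Continuous K := continuous_finsetSum _ fun n _ => continuous_const.mul (hce n)
  have h1 : ∑ n ∈ S, w n * ((‖c n‖ ^ 2 : ℝ) : ℂ) = ∫ x, (starRingEnd ℂ) (g x) * K x ∂μ := by
    rw [hK, ← sum_int μ (fun n x => (starRingEnd ℂ) (e n x)) hce S (fun n => w n * c n) hcg]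
    refine Finset.sum_congr rfl fun n _ => ?_
    have : ∫ x, (starRingEnd ℂ) (g x) * (starRingEnd ℂ) (e n x) ∂μ = (starRingEnd ℂ) (c n) := by
      simp only [hc]
      rw [← integral_conj]
      simp only [map_mul]
    rw [this, mul_assoc, Complex.mul_conj']
    push_cast
    rfl
  have h2 : ‖∫ x, (starRingEnd ℂ) (g x) * K x ∂μ‖ ≤ G * (∫ x, ‖K x‖ ^ p ∂μ) ^ (1 / p) := by
    have := holder μ hpq.symm hcg hKc
    simpa only [RCLike.norm_conj] using this
  have h3 : ∀ x, ‖K x‖ ≤ G * Wp := by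
    intro x
    have hc' : Continuous fun y => ∑ n ∈ S, w n * e n (y - x) :=
      continuous_finsetSum _ fun n _ =>
        continuous_const.mul ((he n).comp (continuous_id.sub continuous_const))
    have : K x = ∫ y, g y * ∑ n ∈ S, w n * e n (y - x) ∂μ := by
      rw [← sum_int μ (fun n y => e n (y - x)) (fun n =>
        (he n).comp (continuous_id.sub continuous_const)) S w hg]
      simp only [hK, hc]
      refine Finset.sum_congr rfl fun n _ => ?_
      rw [mul_assoc, ← integral_mul_const]
      simp only [hes, mul_assoc]
    rw [this]
    refine (holder μ hpq.symm hg hc').trans (le_of_eq ?_)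
    rw [integral_sub_right_eq_self (μ := μ) (fun y => ‖∑ n ∈ S, w n * e n y‖ ^ p) x]
  have h5 : ∫ x, ‖K x‖ ^ 2 ∂μ = ∑ n ∈ S, ‖w n * c n‖ ^ 2 := by
    refine parseval μ (fun n x => (starRingEnd ℂ) (e n x)) hce ?_ S (fun n => w n * c n)
    intro m n
    simp only [Complex.conj_conj]
    simp_rw [mul_comm ((starRingEnd ℂ) (e m _))]
    rw [ho]
    simp only [eq_comm]
  have htriple : (2 * p / (p - 2)).HolderTriple p 2 := by
    refine ⟨?_, by positivity, hp0⟩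
    field_simp
    ring
  have h6 : ∑ n ∈ S, ‖w n * c n‖ ^ 2 ≤ Ω ^ 2 * G ^ 2 := by
    have h := Real.Lr_rpow_le_Lp_mul_Lq_of_nonneg S htriple (f := fun n => ‖w n‖)
      (g := fun n => ‖c n‖) (fun n _ => norm_nonneg _) (fun n _ => norm_nonneg _)
    simp only [Real.rpow_ofNat, ← norm_mul] at h
    refine h.trans (mul_le_mul (le_of_eq ?_) ?_ (by positivity) (by positivity))
    · rw [hΩ, ← Real.rpow_natCast, ← Real.rpow_mul (by positivity)]
      congr 1
      push_cast
      field_simp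
    · refine le_trans (le_of_eq ?_) (pow_le_pow_left₀ (by positivity) hhy 2)
      rw [← Real.rpow_natCast, ← Real.rpow_mul (by positivity)]
      congr 1
      push_cast
      ring
  have h4 : ∫ x, ‖K x‖ ^ p ∂μ ≤ (G * Wp) ^ (p - 2) * (Ω ^ 2 * G ^ 2) := by
    refine le_trans ?_ (mul_le_mul_of_nonneg_left (h5.le.trans h6) (by positivity))
    rw [← integral_const_mul]
    refine integral_mono (cint μ (hKc.norm.rpow_const fun _ => Or.inr hp0.le))
      (cint μ (by fun_prop)) fun x => ?_
    simp only
    calc ‖K x‖ ^ p = ‖K x‖ ^ (p - 2) * ‖K x‖ ^ 2 := by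
          rw [← Real.rpow_ofNat, ← Real.rpow_add_of_nonneg (norm_nonneg _) hp2.le (by norm_num)]
          congr 1; ring
      _ ≤ _ := by
        gcongr
        exact h3 x
  rw [h1]
  refine h2.trans ?_
  rw [sq, mul_assoc]
  refine mul_le_mul_of_nonneg_left ?_ hG0
  refine (Real.rpow_le_rpow (integral_nonneg fun x => by positivity) h4 (by positivity)).trans
    (le_of_eq ?_)
  have hGG : G = G ^ ((p - 2) / p) * G ^ (2 / p) := by
    rw [← Real.rpow_add_of_nonneg hG0 (by positivity) (by positivity)]
    have : (p - 2) / p + 2 / p = 1 := by field_simp; ring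
    rw [this, Real.rpow_one]
  clear_value G Wp Ω
  have hGW : 0 ≤ G * Wp := mul_nonneg hG0 hW0
  rw [Real.mul_rpow (x := (G * Wp) ^ (p - 2)) (by positivity) (by positivity),
    Real.mul_rpow (x := Ω ^ 2) (by positivity) (by positivity),
    ← Real.rpow_mul hGW, ← Real.rpow_natCast, ← Real.rpow_natCast,
    ← Real.rpow_mul hΩ0, ← Real.rpow_mul hG0, Real.mul_rpow hG0 hW0]
  have a1 : (p - 2) * (1 / p) = (p - 2) / p := by ring
  have a2 : ((2 : ℕ) : ℝ) * (1 / p) = 2 / p := by push_cast; ring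
  rw [a1, a2]
  conv_rhs => rw [hGG]
  ring

set_option maxHeartbeats 1000000 in
lemma main_abs {ι : Type*} [AddCommGroup X] [IsTopologicalAddGroup X] (μ : Measure X)
    [IsProbabilityMeasure μ]
    [μ.IsAddRightInvariant] (e : κ → X → ℂ)
    (he : ∀ n, Continuous (e n)) (he1 : ∀ n x, ‖e n x‖ = 1)
    (ho : ∀ m n, ∫ x, e m x * (starRingEnd ℂ) (e n x) ∂μ = if m = n then 1 else 0)
    (hes : ∀ n x y, e n (y - x) = e n y * (starRingEnd ℂ) (e n x))
    (S : Finset κ) {p : ℝ} (hp : 2 < p)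
    (J : Finset ι) (ω : κ → ℝ) (hω : ∀ n, 0 ≤ ω n) (ωj : ι → κ → ℂ) (f : κ → ℂ)
    (hdec : ∀ n ∈ S, (ω n : ℂ) = ∑ j ∈ J, ωj j n) :
    (∫ x, ‖∑ n ∈ S, f n * (ω n : ℂ) * e n x‖ ^ p ∂μ) ^ (1 / p) ≤
      Real.sqrt (∑ n ∈ S, ‖f n‖ ^ 2 * ω n) *
      (∑ j ∈ J, ((∫ x, ‖∑ n ∈ S, ωj j n * e n x‖ ^ p ∂μ) ^ (1 / p)) ^ ((p - 2) / p) *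
        ((∑ n ∈ S, ‖ωj j n‖ ^ (2 * p / (p - 2))) ^ ((p - 2) / (2 * p))) ^ (2 / p)) ^
          ((1 : ℝ) / 2) := by
  have hp0 : 0 < p := by linarith
  have hp2 : 0 < p - 2 := by linarith
  obtain ⟨q, hpq⟩ : ∃ q, p.HolderConjugate q :=
    ⟨_, Real.HolderConjugate.conjExponent (by linarith)⟩
  have hinv : 1 / p + 1 / q = 1 := by simpa using hpq.inv_add_inv_eq_one
  have hq0 : 0 < q := hpq.symm.pos
  set W : X → ℂ := fun x => ∑ n ∈ S, f n * (ω n : ℂ) * e n x with hW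
  have hWc : Continuous W := continuous_finsetSum _ fun n _ => continuous_const.mul (he n)
  set I := ∫ x, ‖W x‖ ^ p ∂μ with hI
  set B := ∑ j ∈ J, ((∫ x, ‖∑ n ∈ S, ωj j n * e n x‖ ^ p ∂μ) ^ (1 / p)) ^ ((p - 2) / p) *
        ((∑ n ∈ S, ‖ωj j n‖ ^ (2 * p / (p - 2))) ^ ((p - 2) / (2 * p))) ^ (2 / p) with hB
  have hI0 : 0 ≤ I := integral_nonneg fun x => by positivity
  have hB0 : 0 ≤ B := Finset.sum_nonneg fun j _ => mul_nonneg
    (Real.rpow_nonneg (Real.rpow_nonneg (integral_nonneg fun x => by positivity) _) _)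
    (by positivity)
  rcases hI0.eq_or_lt with h0 | hIpos
  · rw [← h0, Real.zero_rpow (by positivity)]
    exact mul_nonneg (Real.sqrt_nonneg _) (Real.rpow_nonneg hB0 _)
  let g : X → ℂ := fun x => (starRingEnd ℂ) (W x) * ((‖W x‖ ^ (p - 2) : ℝ) : ℂ)
  have hgc : Continuous g := (Complex.continuous_conj.comp hWc).mul
    (Complex.continuous_ofReal.comp (hWc.norm.rpow_const fun _ => Or.inr hp2.le))
  have hgW : ∀ x, g x * W x = ((‖W x‖ ^ p : ℝ) : ℂ) := fun x => by
    have : g x * W x = (W x * (starRingEnd ℂ) (W x)) * ((‖W x‖ ^ (p - 2) : ℝ) : ℂ) := by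
      simp only [g]; ring
    rw [this, Complex.mul_conj']
    norm_cast
    rw [← Real.rpow_ofNat, ← Real.rpow_add_of_nonneg (norm_nonneg _) (by norm_num) hp2.le]
    congr 1; ring
  have hgn : ∀ x, ‖g x‖ ^ q = ‖W x‖ ^ p := fun x => by
    simp only [g]
    rw [norm_mul, RCLike.norm_conj, Complex.norm_real, Real.norm_of_nonneg (by positivity)]
    nth_rewrite 1 [← Real.rpow_one ‖W x‖]
    rw [← Real.rpow_add_of_nonneg (norm_nonneg _) zero_le_one hp2.le,
      ← Real.rpow_mul (norm_nonneg _)]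
    congr 1
    have := hpq.sub_one_mul_conj
    linarith
  set c : κ → ℂ := fun n => ∫ x, g x * e n x ∂μ with hc
  have hIsum : (I : ℂ) = ∑ n ∈ S, (f n * ω n) * c n := by
    rw [hc, sum_int μ e he S (fun n => f n * (ω n : ℂ)) hgc, hI, ← integral_complex_ofReal]
    exact integral_congr_ae (Filter.Eventually.of_forall fun x => (hgW x).symm)
  have hQ : ∑ n ∈ S, ω n * ‖c n‖ ^ 2 ≤ (I ^ (1 / q)) ^ 2 * B := by
    have hG : ∫ x, ‖g x‖ ^ q ∂μ = I := by simp only [hgn, hI]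
    have : ((∑ n ∈ S, ω n * ‖c n‖ ^ 2 : ℝ) : ℂ) =
        ∑ j ∈ J, ∑ n ∈ S, ωj j n * ((‖c n‖ ^ 2 : ℝ) : ℂ) := by
      rw [Finset.sum_comm]
      push_cast
      refine Finset.sum_congr rfl fun n hn => ?_
      rw [hdec n hn, Finset.sum_mul]
    calc ∑ n ∈ S, ω n * ‖c n‖ ^ 2 = ‖((∑ n ∈ S, ω n * ‖c n‖ ^ 2 : ℝ) : ℂ)‖ := by
          rw [Complex.norm_real, Real.norm_of_nonneg]
          exact Finset.sum_nonneg fun n _ => mul_nonneg (hω n) (by positivity)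
      _ ≤ ∑ j ∈ J, ‖∑ n ∈ S, ωj j n * ((‖c n‖ ^ 2 : ℝ) : ℂ)‖ := by
          rw [this]; exact norm_sum_le _ _
      _ ≤ _ := by
        rw [hB, Finset.mul_sum]
        refine Finset.sum_le_sum fun j _ => ?_
        have h := perj μ e he he1 ho hes S hp hpq hgc (ωj j)
        rw [hG] at h
        exact h
  have hCS : I ≤ Real.sqrt (∑ n ∈ S, ‖f n‖ ^ 2 * ω n) * Real.sqrt (∑ n ∈ S, ω n * ‖c n‖ ^ 2) := by
    calc I = ‖(I : ℂ)‖ := by rw [Complex.norm_real, Real.norm_of_nonneg hI0]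
      _ ≤ ∑ n ∈ S, ‖(f n * ω n) * c n‖ := by rw [hIsum]; exact norm_sum_le _ _
      _ = ∑ n ∈ S, Real.sqrt (‖f n‖ ^ 2 * ω n) * Real.sqrt (ω n * ‖c n‖ ^ 2) := by
        refine Finset.sum_congr rfl fun n _ => ?_
        rw [norm_mul, norm_mul, Complex.norm_real, Real.norm_of_nonneg (hω n),
          Real.sqrt_mul (by positivity), Real.sqrt_mul (hω n), Real.sqrt_sq (norm_nonneg _),
          Real.sqrt_sq (norm_nonneg _)]
        nth_rewrite 1 [← Real.mul_self_sqrt (hω n)]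
        ring
      _ ≤ _ := Real.sum_sqrt_mul_sqrt_le S (fun n => mul_nonneg (by positivity) (hω n))
        (fun n => mul_nonneg (hω n) (by positivity))
  have hfin : I ≤ I ^ (1 / q) * (Real.sqrt (∑ n ∈ S, ‖f n‖ ^ 2 * ω n) * B ^ ((1:ℝ) / 2)) := by
    refine hCS.trans ((mul_le_mul_of_nonneg_left (Real.sqrt_le_sqrt hQ)
      (Real.sqrt_nonneg _)).trans (le_of_eq ?_))
    rw [Real.sqrt_mul (by positivity), Real.sqrt_sq (by positivity), Real.sqrt_eq_rpow B]
    ring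
  have hIq : 0 < I ^ (1 / q) := Real.rpow_pos_of_pos hIpos _
  refine le_of_mul_le_mul_left ?_ hIq
  refine le_trans (le_of_eq ?_) hfin
  rw [← Real.rpow_add hIpos, add_comm, hinv, Real.rpow_one]

end general

noncomputable section torus

/-- Haar probability measure on the torus -/
def mu (d : ℕ) : Measure (Fin d → UnitAddCircle) :=
  Measure.pi fun _ => AddCircle.haarAddCircle

instance (d : ℕ) : IsProbabilityMeasure (mu d) := by unfold mu; infer_instance

instance (d : ℕ) : (mu d).IsAddLeftInvariant := by unfold mu; infer_instance

/-- the characters -/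
def ee (d : ℕ) (n : Fin d → ℕ) (x : Fin d → UnitAddCircle) : ℂ :=
  UnitAddTorus.mFourier (fun i => (n i : ℤ)) x

lemma ee_cont (d : ℕ) (n : Fin d → ℕ) : Continuous (ee d n) :=
  (UnitAddTorus.mFourier (fun i => (n i : ℤ))).continuous

lemma ee_prod (d : ℕ) (n : Fin d → ℕ) (x : Fin d → UnitAddCircle) :
    ee d n x = ∏ i, fourier (n i : ℤ) (x i) := rfl

lemma ee_norm (d : ℕ) (n : Fin d → ℕ) (x : Fin d → UnitAddCircle) : ‖ee d n x‖ = 1 := by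
  rw [ee_prod, norm_prod]
  refine Finset.prod_eq_one fun i _ => ?_
  rw [fourier_apply]
  exact Circle.norm_coe _

lemma ee_sub (d : ℕ) (n : Fin d → ℕ) (x y : Fin d → UnitAddCircle) :
    ee d n (y - x) = ee d n y * (starRingEnd ℂ) (ee d n x) := by
  simp only [ee_prod, map_prod, ← Finset.prod_mul_distrib]
  refine Finset.prod_congr rfl fun i _ => ?_
  rw [← fourier_neg]
  simp only [fourier_apply, Pi.sub_apply, neg_smul]
  rw [zsmul_sub, sub_eq_add_neg, AddCircle.toCircle_add, Circle.coe_mul]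

lemma ee_orth (d : ℕ) (m n : Fin d → ℕ) :
    ∫ x, ee d m x * (starRingEnd ℂ) (ee d n x) ∂(mu d) = if m = n then 1 else 0 := by
  have h := orthonormal_iff_ite.mp (UnitAddTorus.orthonormal_mFourier (d := Fin d))
    (fun i => (n i : ℤ)) (fun i => (m i : ℤ))
  simp only [UnitAddTorus.mFourierLp, ContinuousMap.inner_toLp] at h
  have e : ((fun i => (n i : ℤ)) = fun i => (m i : ℤ)) ↔ m = n := by
    constructor
    · intro h'
      funext i
      have := congrFun h' i
      exact_mod_cast this.symm
    · rintro rfl; rfl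
  simp only [e] at h
  exact h

lemma transfer (d : ℕ) (F : (Fin d → UnitAddCircle) → ℝ) :
    ∫ x, F x ∂(mu d) =
      ∫ α in Set.univ.pi (fun _ : Fin d => Set.Icc (0:ℝ) 1), F (fun i => (α i : UnitAddCircle)) := by
  have h := UnitAddTorus.integral_preimage F (fun _ : Fin d => (0 : ℝ))
  refine Eq.trans h ?_
  refine setIntegral_congr_set ?_
  have h2 : {x : Fin d → ℝ | ∀ i, x i ∈ Set.Ioc (0 : ℝ) (0 + 1)} =
      Set.univ.pi fun _ => Set.Ioc (0 : ℝ) 1 := by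
    ext x; simp
  rw [h2, Set.pi_univ_Icc]
  exact Measure.univ_pi_Ioc_ae_eq_Icc

lemma ee_coe (d : ℕ) (n : Fin d → ℕ) (α : Fin d → ℝ) :
    ee d n (fun i => (α i : UnitAddCircle)) =
      Complex.exp (2 * Real.pi * Complex.I * (∑ i, α i * (n i : ℝ))) := by
  rw [ee_prod, Complex.ofReal_sum, Finset.mul_sum, Complex.exp_sum]
  refine Finset.prod_congr rfl fun i _ => ?_
  rw [fourier_coe_apply]
  congr 1
  push_cast
  ring

end torus

end HYaux

theorem stmt_14 {ι : Type*} (d : ℕ) (hd : 0 < d) (Nv : Fin d → ℕ)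
    (J : Finset ι) (ω : (Fin d → ℕ) → ℝ) (hω : ∀ n, 0 ≤ ω n)
    (ωj : ι → (Fin d → ℕ) → ℂ) (f : (Fin d → ℕ) → ℂ)
    (hdec : ∀ n ∈ Fintype.piFinset (fun i => Finset.Icc 1 (Nv i)),
      (ω n : ℂ) = ∑ j ∈ J, ωj j n)
    (p : ℝ) (hp : 2 < p) :
    (∫ α in Set.univ.pi (fun _ : Fin d => Set.Icc (0:ℝ) 1),
        ‖∑ n ∈ Fintype.piFinset (fun i => Finset.Icc 1 (Nv i)),
          f n * (ω n : ℂ) *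
            Complex.exp (2 * Real.pi * Complex.I * (∑ i, α i * (n i : ℝ)))‖ ^ p) ^ (1/p)
      ≤ Real.sqrt (∑ n ∈ Fintype.piFinset (fun i => Finset.Icc 1 (Nv i)),
          ‖f n‖ ^ 2 * ω n) *
        (∑ j ∈ J,
          ((∫ α in Set.univ.pi (fun _ : Fin d => Set.Icc (0:ℝ) 1),
              ‖∑ n ∈ Fintype.piFinset (fun i => Finset.Icc 1 (Nv i)),
                ωj j n *
                  Complex.exp (2 * Real.pi * Complex.I *
                    (∑ i, α i * (n i : ℝ)))‖ ^ p) ^ (1/p)) ^ ((p - 2)/p) *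
            ((∑ n ∈ Fintype.piFinset (fun i => Finset.Icc 1 (Nv i)),
              ‖ωj j n‖ ^ (2*p/(p-2))) ^ ((p-2)/(2*p))) ^ (2/p)) ^ ((1:ℝ)/2) := by
  have key : ∀ w : (Fin d → ℕ) → ℂ,
      ∫ α in Set.univ.pi (fun _ : Fin d => Set.Icc (0:ℝ) 1),
        ‖∑ n ∈ Fintype.piFinset (fun i => Finset.Icc 1 (Nv i)),
          w n * Complex.exp (2 * Real.pi * Complex.I * (∑ i, α i * (n i : ℝ)))‖ ^ p =
      ∫ x, ‖∑ n ∈ Fintype.piFinset (fun i => Finset.Icc 1 (Nv i)),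
          w n * HYaux.ee d n x‖ ^ p ∂(HYaux.mu d) := by
    intro w
    rw [HYaux.transfer]
    refine setIntegral_congr_fun (MeasurableSet.univ_pi fun _ => measurableSet_Icc) fun α _ => ?_
    simp only [HYaux.ee_coe]
  have h := HYaux.main_abs (HYaux.mu d) (HYaux.ee d) (HYaux.ee_cont d) (HYaux.ee_norm d)
    (HYaux.ee_orth d) (HYaux.ee_sub d) (Fintype.piFinset (fun i => Finset.Icc 1 (Nv i))) hp
    J ω hω ωj f hdec
  rw [key (fun n => f n * (ω n : ℂ))]
  simp only [key]
  exact h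
end

section
/- Let g : {1,...,N} → ℂ satisfy |g(n)| ≤ 1 and define V_g(α1, α2) = Σ_{n ≤ N} g(n) e(α2 n² + α1 n). Then for every p > 6, ∫_{T²} |V_g(α)|^p dα ≪_p N^{p−3}. -/
open Finset Complex MeasureTheory

/-- the divisor bound -/
lemma divisor_bound (ε : ℝ) (hε : 0 < ε) : ∃ C : ℝ, 1 ≤ C ∧ ∀ n : ℕ, 0 < n →
    ((n.divisors.card : ℕ) : ℝ) ≤ C * (n : ℝ) ^ ε := by
  obtain ⟨P, hP⟩ := exists_nat_ge ((2:ℝ) ^ (1 / ε))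
  set C0 : ℝ := max 1 (1 / (ε * Real.log 2)) with hC0
  have hl2 : 0 < Real.log 2 := Real.log_pos (by norm_num)
  have hC01 : 1 ≤ C0 := le_max_left _ _
  refine ⟨C0 ^ P, one_le_pow₀ hC01, fun n hn => ?_⟩
  have key : ∀ p ∈ n.primeFactors, ((n.factorization p + 1 : ℕ) : ℝ) ≤
      (if p < P then C0 else 1) * ((p : ℝ) ^ n.factorization p) ^ ε := by
    intro p hp
    have hpp : p.Prime := Nat.prime_of_mem_primeFactors hp
    have hp2 : (2:ℝ) ≤ p := by exact_mod_cast hpp.two_le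
    set f := n.factorization p
    have e1 : ((p : ℝ) ^ f) ^ ε = ((p : ℝ) ^ ε) ^ f := by
      rw [← Real.rpow_natCast, ← Real.rpow_natCast, ← Real.rpow_mul (by positivity),
        ← Real.rpow_mul (by positivity), mul_comm]
    rw [e1]
    split_ifs with h
    · have h1 : ((2:ℝ) ^ ε) ^ f ≤ ((p : ℝ) ^ ε) ^ f := by gcongr
      have h2 : 1 + f * (ε * Real.log 2) ≤ ((2:ℝ) ^ ε) ^ f := by
        rw [← Real.rpow_natCast, ← Real.rpow_mul (by norm_num), Real.rpow_def_of_pos (by norm_num)]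
        have := Real.add_one_le_exp (Real.log 2 * (ε * f))
        linarith
      have h3 : 1 ≤ C0 * (ε * Real.log 2) := by
        have : 1 / (ε * Real.log 2) ≤ C0 := le_max_right _ _
        rwa [div_le_iff₀ (by positivity)] at this
      push_cast
      calc (f:ℝ) + 1 ≤ C0 * (1 + f * (ε * Real.log 2)) := by
            have : (f:ℝ) * 1 ≤ f * (C0 * (ε * Real.log 2)) := by gcongr
            nlinarith
        _ ≤ _ := by gcongr; linarith
    · rw [one_mul]
      have h2 : (2:ℝ) ≤ (p:ℝ) ^ ε := by
        have : (2:ℝ) ^ (1 / ε) ≤ p := hP.trans (by exact_mod_cast not_lt.mp h)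
        calc (2:ℝ) = ((2:ℝ) ^ (1 / ε)) ^ ε := by
              rw [← Real.rpow_mul (by norm_num)]; field_simp; simp
          _ ≤ _ := by gcongr
      calc ((f + 1 : ℕ) : ℝ) ≤ ((2 ^ f : ℕ) : ℝ) := by exact_mod_cast Nat.lt_two_pow_self
        _ = (2:ℝ) ^ f := by push_cast; rfl
        _ ≤ _ := by gcongr
  rw [Nat.card_divisors hn.ne']
  push_cast at key ⊢
  calc ∏ x ∈ n.primeFactors, ((n.factorization x : ℝ) + 1)
      ≤ ∏ p ∈ n.primeFactors, ((if p < P then C0 else 1) * ((p : ℝ) ^ n.factorization p) ^ ε) :=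
        Finset.prod_le_prod (fun _ _ => by positivity) key
    _ = (∏ p ∈ n.primeFactors, (if p < P then C0 else 1)) * (n:ℝ) ^ ε := by
        rw [Finset.prod_mul_distrib, Real.finsetProd_rpow _ _ (fun _ _ => by positivity)]
        congr 2
        conv_rhs => rw [← Nat.prod_factorization_pow_eq_self hn.ne']
        rw [Finsupp.prod]; push_cast; rfl
    _ ≤ _ := by
        gcongr
        rw [Finset.prod_ite, Finset.prod_const, Finset.prod_const, one_pow, mul_one]
        apply pow_le_pow_right₀ hC01
        calc _ ≤ (Finset.range P).card := Finset.card_le_card (by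
              intro x; simp +contextual)
          _ = P := by simp

/-- the additive character -/
noncomputable def ee (x : ℝ) : ℂ := Complex.exp (2 * Real.pi * Complex.I * x)

lemma ee_add (x y : ℝ) : ee (x + y) = ee x * ee y := by
  simp only [ee, ← Complex.exp_add]; congr 1; push_cast; ring

lemma norm_ee (x : ℝ) : ‖ee x‖ = 1 := by
  have : ee x = Complex.exp ((2 * Real.pi * x : ℝ) * Complex.I) := by
    simp only [ee]; congr 1; push_cast; ring
  rw [this, Complex.norm_exp_ofReal_mul_I]

lemma ee_zero : ee 0 = 1 := by simp [ee]

lemma conj_ee (x : ℝ) : (starRingEnd ℂ) (ee x) = ee (-x) := by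
  simp only [ee, ← Complex.exp_conj]; congr 1
  rw [map_mul, map_mul, map_mul, Complex.conj_I, Complex.conj_ofReal, Complex.conj_ofReal, Complex.conj_ofNat]
  push_cast; ring

lemma ee_int (n : ℤ) : ee n = 1 := by
  simp only [ee]
  rw [← Complex.exp_int_mul_two_pi_mul_I n]; congr 1; push_cast; ring

lemma ee_nat_mul (n : ℕ) (x : ℝ) : ee (n * x) = ee x ^ n := by
  simp only [ee, ← Complex.exp_nat_mul]; congr 1; push_cast; ring

lemma continuous_ee : Continuous ee := by unfold ee; fun_prop

lemma integral_ee (n : ℤ) : ∫ x in Set.Icc (0:ℝ) 1, ee (n * x) = if n = 0 then 1 else 0 := by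
  rw [integral_Icc_eq_integral_Ioc, ← intervalIntegral.integral_of_le zero_le_one]
  split_ifs with h
  · simp [h, ee_zero]
  · have hc : (2 * Real.pi * Complex.I * n : ℂ) ≠ 0 := by
      simp [h, Real.pi_ne_zero]
    have : ∀ x : ℝ, ee (n * x) = Complex.exp ((2 * Real.pi * Complex.I * n : ℂ) * x) := by
      intro x; simp only [ee]; congr 1; push_cast; ring
    simp only [this]
    rw [integral_exp_mul_complex hc]
    have : Complex.exp (2 * Real.pi * Complex.I * n) = 1 := by
      rw [← Complex.exp_int_mul_two_pi_mul_I n]; congr 1; ring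
    simp [this]

/-- the unit square measure -/
noncomputable def usq : Set (ℝ × ℝ) := Set.Icc ((0:ℝ), (0:ℝ)) (1, 1)

lemma usq_eq : usq = Set.Icc (0:ℝ) 1 ×ˢ Set.Icc (0:ℝ) 1 := by
  rw [usq, Set.Icc_prod_eq]

lemma isCompact_usq : IsCompact usq := by rw [usq_eq]; exact isCompact_Icc.prod isCompact_Icc

lemma measurableSet_usq : MeasurableSet usq := isCompact_usq.measurableSet

lemma vol_usq : (volume : Measure (ℝ × ℝ)) usq = 1 := by
  rw [usq_eq, Measure.volume_eq_prod, Measure.prod_prod]; simp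

lemma integral_usq_ee (m n : ℤ) : ∫ α in usq, ee (m * α.1 + n * α.2) =
    if m = 0 ∧ n = 0 then 1 else 0 := by
  simp only [ee_add]
  rw [usq_eq, Measure.volume_eq_prod]
  rw [setIntegral_prod_mul (fun x => ee (m * x)) (fun x => ee (n * x)), integral_ee, integral_ee]
  split_ifs <;> simp_all

lemma intOn_usq {E : Type*} [NormedAddCommGroup E] {f : ℝ × ℝ → E} (hf : Continuous f) :
    IntegrableOn f usq := hf.continuousOn.integrableOn_compact isCompact_usq

lemma parseval {ι : Type*} (s : Finset ι) (a : ι → ℂ) (φ ψ : ι → ℤ) :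
    (∫ α in usq, ‖∑ i ∈ s, a i * ee (φ i * α.1 + ψ i * α.2)‖ ^ 2) =
     (∑ i ∈ s, ∑ j ∈ s, if φ i = φ j ∧ ψ i = ψ j then a i * (starRingEnd ℂ) (a j) else 0).re := by
  have h1 : ((∫ α in usq, ‖∑ i ∈ s, a i * ee (φ i * α.1 + ψ i * α.2)‖ ^ 2 : ℝ) : ℂ) =
     (∑ i ∈ s, ∑ j ∈ s, if φ i = φ j ∧ ψ i = ψ j then a i * (starRingEnd ℂ) (a j) else 0) := by
    rw [← integral_complex_ofReal]
    have h2 : ∀ α : ℝ × ℝ, ((‖∑ i ∈ s, a i * ee (φ i * α.1 + ψ i * α.2)‖ ^ 2 : ℝ) : ℂ) =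
      ∑ i ∈ s, ∑ j ∈ s, a i * (starRingEnd ℂ) (a j) *
        ee ((φ i - φ j : ℤ) * α.1 + (ψ i - ψ j : ℤ) * α.2) := by
      intro α
      push_cast
      rw [← Complex.mul_conj', map_sum, Finset.sum_mul_sum]
      refine Finset.sum_congr rfl fun i _ => Finset.sum_congr rfl fun j _ => ?_
      rw [map_mul, conj_ee]
      have : ((φ i - φ j : ℤ) * α.1 + (ψ i - ψ j : ℤ) * α.2 : ℝ) =
        (φ i * α.1 + ψ i * α.2) + -(φ j * α.1 + ψ j * α.2) := by push_cast; ring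
      push_cast at this ⊢
      rw [this, ee_add (φ i * α.1 + ψ i * α.2)]; ring
    simp only [h2]
    have hc : ∀ (i j : ι), Continuous fun α : ℝ × ℝ => a i * (starRingEnd ℂ) (a j) *
        ee ((φ i - φ j : ℤ) * α.1 + (ψ i - ψ j : ℤ) * α.2) := by
      intro i j
      exact continuous_const.mul (continuous_ee.comp (by fun_prop))
    rw [integral_finsetSum _ (fun i _ => (intOn_usq (continuous_finsetSum _ fun j _ => hc i j)))]
    refine Finset.sum_congr rfl fun i _ => ?_
    rw [integral_finsetSum _ (fun j _ => (intOn_usq (hc i j)))]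
    refine Finset.sum_congr rfl fun j _ => ?_
    rw [integral_const_mul, integral_usq_ee]
    simp [sub_eq_zero]
  rw [← h1, Complex.ofReal_re]

lemma parseval_inj {ι : Type*} (s : Finset ι) (a : ι → ℂ) (φ ψ : ι → ℤ)
    (hinj : ∀ i ∈ s, ∀ j ∈ s, φ i = φ j → ψ i = ψ j → i = j) :
    (∫ α in usq, ‖∑ i ∈ s, a i * ee (φ i * α.1 + ψ i * α.2)‖ ^ 2) = ∑ i ∈ s, ‖a i‖ ^ 2 := by
  classical
  rw [parseval, Complex.re_sum]
  refine Finset.sum_congr rfl fun i hi => ?_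
  rw [Finset.sum_eq_single i]
  · simp [Complex.mul_conj']; norm_cast
  · intro j hj hji
    rw [if_neg]
    rintro ⟨h1, h2⟩
    exact hji (hinj i hi j hj h1 h2).symm
  · exact fun h => (h hi).elim

lemma parseval_le {ι : Type*} (s : Finset ι) (a : ι → ℂ) (ha : ∀ i, ‖a i‖ ≤ 1) (φ ψ : ι → ℤ) :
    (∫ α in usq, ‖∑ i ∈ s, a i * ee (φ i * α.1 + ψ i * α.2)‖ ^ 2) ≤
      ∑ i ∈ s, (((s.filter fun j => φ i = φ j ∧ ψ i = ψ j).card : ℕ) : ℝ) := by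
  rw [parseval, Complex.re_sum]
  refine Finset.sum_le_sum fun i hi => ?_
  rw [Complex.re_sum, Finset.card_filter]
  push_cast
  refine Finset.sum_le_sum fun j hj => ?_
  split_ifs
  · refine (Complex.re_le_norm _).trans ?_
    rw [norm_mul, RCLike.norm_conj]
    exact mul_le_one₀ (ha i) (norm_nonneg _) (ha j)
  · simp

/-- the exponential sum -/
noncomputable def VV (N : ℕ) (g : ℕ → ℂ) (α : ℝ × ℝ) : ℂ :=
  ∑ n ∈ Finset.Icc 1 N, g n * ee (n * α.1 + (n:ℝ) ^ 2 * α.2)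

lemma continuous_VV (N : ℕ) (g : ℕ → ℂ) : Continuous (VV N g) := by
  unfold VV
  refine continuous_finsetSum _ fun n _ => continuous_const.mul (continuous_ee.comp (by fun_prop))

lemma norm_VV_le (N : ℕ) (g : ℕ → ℂ) (hg : ∀ n, ‖g n‖ ≤ 1) (α : ℝ × ℝ) : ‖VV N g α‖ ≤ N := by
  unfold VV
  refine (norm_sum_le _ _).trans ?_
  calc ∑ n ∈ Finset.Icc 1 N, ‖g n * ee (n * α.1 + (n:ℝ) ^ 2 * α.2)‖
      ≤ ∑ n ∈ Finset.Icc 1 N, (1:ℝ) := by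
        refine Finset.sum_le_sum fun n _ => ?_
        rw [norm_mul, norm_ee, mul_one]; exact hg n
    _ = N := by simp

def tri (N : ℕ) : Finset (ℕ × ℕ × ℕ) := Finset.Icc 1 N ×ˢ Finset.Icc 1 N ×ˢ Finset.Icc 1 N

def trp (i : ℕ × ℕ × ℕ) : ℤ := i.1 + i.2.1 - i.2.2
def trq (i : ℕ × ℕ × ℕ) : ℤ := (i.1:ℤ) ^ 2 + (i.2.1 : ℤ) ^ 2 - (i.2.2 : ℤ) ^ 2

def fib (N : ℕ) (i : ℕ × ℕ × ℕ) : Finset (ℕ × ℕ × ℕ) :=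
  (tri N).filter fun j => trp i = trp j ∧ trq i = trq j

lemma fib_prod {N : ℕ} {i j : ℕ × ℕ × ℕ} (h : j ∈ fib N i) :
    ((j.1:ℤ) - j.2.2) * (j.2.1 - j.2.2) = ((i.1:ℤ) - i.2.2) * (i.2.1 - i.2.2) := by
  rw [fib, Finset.mem_filter] at h
  simp only [trp, trq] at h
  obtain ⟨_, h1, h2⟩ := h
  have : 2 * (((j.1:ℤ) - j.2.2) * (j.2.1 - j.2.2)) = 2 * (((i.1:ℤ) - i.2.2) * (i.2.1 - i.2.2)) := by
    have e : ((i.1:ℤ) + i.2.1 - i.2.2) ^ 2 = ((j.1:ℤ) + j.2.1 - j.2.2) ^ 2 := by rw [h1]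
    linarith
  linarith

lemma fib_card_nondeg (N : ℕ) (i : ℕ × ℕ × ℕ)
    (h0 : ((i.1:ℤ) - i.2.2) * (i.2.1 - i.2.2) ≠ 0) :
    (fib N i).card ≤ 2 * (Nat.divisors (((i.1:ℤ) - i.2.2) * (i.2.1 - i.2.2)).natAbs).card := by
  set P := ((i.1:ℤ) - i.2.2) * (i.2.1 - i.2.2) with hP
  have : (fib N i).card ≤ ((Finset.univ : Finset Bool) ×ˢ Nat.divisors P.natAbs).card := by
    refine Finset.card_le_card_of_injOn
      (fun j => (decide (0 ≤ (j.1:ℤ) - j.2.2), ((j.1:ℤ) - j.2.2).natAbs)) ?_ ?_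
    · intro j hj
      have := fib_prod hj
      simp only [Finset.coe_product, Set.mem_prod, Finset.mem_coe, Finset.mem_univ, true_and,
        Nat.mem_divisors]
      refine ⟨Int.natAbs_dvd_natAbs.mpr (Dvd.intro _ this), by simpa using h0⟩
    · intro j hj k hk hjk
      have h1 := fib_prod hj
      have h2 := fib_prod hk
      simp only [Finset.mem_coe] at hj hk
      rw [fib, Finset.mem_filter] at hj hk
      simp only [trp, trq] at hj hk
      obtain ⟨_, a1, a2⟩ := hj
      obtain ⟨_, b1, b2⟩ := hk
      simp only [Prod.mk.injEq, decide_eq_decide] at hjk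
      obtain ⟨c1, c2⟩ := hjk
      have e1 : (j.1:ℤ) - j.2.2 = k.1 - k.2.2 := by
        rcases Int.natAbs_eq_natAbs_iff.mp c2 with h | h
        · exact h
        · omega
      have hne : (j.1:ℤ) - j.2.2 ≠ 0 := by
        intro h; rw [h, zero_mul] at h1; exact h0 h1.symm
      have e2 : (j.2.1:ℤ) - j.2.2 = k.2.1 - k.2.2 := by
        rw [← h2, ← e1] at h1
        exact mul_left_cancel₀ hne h1
      ext <;> omega
  simpa using this

lemma fib_card_deg (N : ℕ) (i : ℕ × ℕ × ℕ)
    (h0 : ((i.1:ℤ) - i.2.2) * (i.2.1 - i.2.2) = 0) :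
    (fib N i).card ≤ 2 * N := by
  have : (fib N i).card ≤ ((Finset.univ : Finset Bool) ×ˢ Finset.Icc 1 N).card := by
    refine Finset.card_le_card_of_injOn
      (fun j => if j.1 = j.2.2 then (true, j.1) else (false, j.2.1)) ?_ ?_
    · intro j hj
      simp only [Finset.mem_coe] at hj
      simp only [fib, tri, Finset.mem_filter, Finset.mem_product] at hj
      simp only [Finset.coe_product, Set.mem_prod, Finset.mem_coe]
      split_ifs
      · exact ⟨Finset.mem_univ _, hj.1.1⟩
      · exact ⟨Finset.mem_univ _, hj.1.2.1⟩
    · intro j hj k hk hjk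
      have h1 := fib_prod hj
      have h2 := fib_prod hk
      simp only [Finset.mem_coe] at hj hk
      rw [fib, Finset.mem_filter] at hj hk
      simp only [trp, trq] at hj hk
      obtain ⟨_, a1, a2⟩ := hj
      obtain ⟨_, b1, b2⟩ := hk
      rw [h0, mul_eq_zero] at h1 h2
      dsimp only at hjk
      split_ifs at hjk with u1 u2 u2 <;> simp only [Prod.mk.injEq] at hjk
      · ext <;> omega
      · simp at hjk
      · simp at hjk
      · ext <;> omega
  simpa using this

lemma VV_cube (N : ℕ) (g : ℕ → ℂ) (α : ℝ × ℝ) : ‖VV N g α‖ ^ 6 =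
    ‖∑ i ∈ tri N, (g i.1 * g i.2.1 * (starRingEnd ℂ) (g i.2.2)) *
      ee (trp i * α.1 + trq i * α.2)‖ ^ 2 := by
  have : ∑ i ∈ tri N, (g i.1 * g i.2.1 * (starRingEnd ℂ) (g i.2.2)) *
      ee (trp i * α.1 + trq i * α.2) = VV N g α * (VV N g α * (starRingEnd ℂ) (VV N g α)) := by
    rw [VV, map_sum, Finset.sum_mul_sum, Finset.sum_mul_sum, tri, Finset.sum_product]
    simp only [Finset.sum_product, Finset.mul_sum]
    refine Finset.sum_congr rfl fun x _ => Finset.sum_congr rfl fun y _ =>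
      Finset.sum_congr rfl fun z _ => ?_
    have : (trp (x, y, z) * α.1 + trq (x, y, z) * α.2 : ℝ) = (x * α.1 + (x:ℝ) ^ 2 * α.2) +
      ((y * α.1 + (y:ℝ) ^ 2 * α.2) + -(z * α.1 + (z:ℝ) ^ 2 * α.2)) := by
      simp only [trp, trq]; push_cast; ring
    rw [this, ee_add (x * α.1 + (x:ℝ) ^ 2 * α.2), ee_add (y * α.1 + (y:ℝ) ^ 2 * α.2), map_mul,
      conj_ee]
    ring
  rw [this, norm_mul, norm_mul, RCLike.norm_conj]; ring

lemma sixth_moment (ε : ℝ) (hε : 0 < ε) : ∃ C : ℝ, 0 < C ∧ ∀ (N : ℕ) (g : ℕ → ℂ), 0 < N →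
    (∀ n, ‖g n‖ ≤ 1) → ∫ α in usq, ‖VV N g α‖ ^ 6 ≤ C * (N:ℝ) ^ (3 + ε) := by
  obtain ⟨C, hC1, hC⟩ := divisor_bound (ε / 2) (by positivity)
  refine ⟨2 * C + 4, by positivity, fun N g hN hg => ?_⟩
  have hN1 : (1:ℝ) ≤ N := by exact_mod_cast hN
  simp only [VV_cube]
  refine (parseval_le (tri N) _ ?_ trp trq).trans ?_
  · intro i
    rw [norm_mul, norm_mul, RCLike.norm_conj]
    exact mul_le_one₀ (mul_le_one₀ (hg _) (norm_nonneg _) (hg _)) (norm_nonneg _) (hg _)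
  have hNe : 1 ≤ (N:ℝ) ^ ε := Real.one_le_rpow hN1 hε.le
  have hb : ∀ i ∈ tri N, (((fib N i).card : ℕ) : ℝ) ≤ 2 * C * (N:ℝ) ^ ε +
      ((if i.1 = i.2.2 then 2 * (N:ℝ) else 0) + (if i.2.1 = i.2.2 then 2 * (N:ℝ) else 0)) := by
    intro i hi
    have hpos : (0:ℝ) ≤ 2 * C * (N:ℝ) ^ ε := by positivity
    have hp1 : (0:ℝ) ≤ (if i.1 = i.2.2 then 2 * (N:ℝ) else 0) := by split_ifs <;> positivity
    have hp2 : (0:ℝ) ≤ (if i.2.1 = i.2.2 then 2 * (N:ℝ) else 0) := by split_ifs <;> positivity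
    by_cases h0 : ((i.1:ℤ) - i.2.2) * (i.2.1 - i.2.2) = 0
    · have h1 : (((fib N i).card : ℕ) : ℝ) ≤ 2 * N := by exact_mod_cast fib_card_deg N i h0
      rcases mul_eq_zero.mp h0 with h | h
      · have : i.1 = i.2.2 := by omega
        rw [if_pos this] at hp1 ⊢; linarith
      · have : i.2.1 = i.2.2 := by omega
        rw [if_pos this] at hp2 ⊢; linarith
    · have h1 : (((fib N i).card : ℕ) : ℝ) ≤
          2 * ((Nat.divisors (((i.1:ℤ) - i.2.2) * (i.2.1 - i.2.2)).natAbs).card : ℕ) := by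
        exact_mod_cast fib_card_nondeg N i h0
      have h2 := hC _ (Int.natAbs_pos.mpr h0)
      have h3 : ((((i.1:ℤ) - i.2.2) * (i.2.1 - i.2.2)).natAbs : ℝ) ≤ (N:ℝ) ^ 2 := by
        simp only [tri, Finset.mem_product, Finset.mem_Icc] at hi
        rw [Int.natAbs_mul, pow_two]; push_cast
        have : ((i.1:ℤ) - i.2.2).natAbs ≤ N := by omega
        have : ((i.2.1:ℤ) - i.2.2).natAbs ≤ N := by omega
        gcongr
      have h4 : ((((i.1:ℤ) - i.2.2) * (i.2.1 - i.2.2)).natAbs : ℝ) ^ (ε / 2) ≤ (N:ℝ) ^ ε := by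
        calc _ ≤ ((N:ℝ) ^ 2) ^ (ε / 2) := by gcongr
          _ = _ := by rw [← Real.rpow_natCast, ← Real.rpow_mul (by positivity)]; congr 1; push_cast; ring
      have : C * ((((i.1:ℤ) - i.2.2) * (i.2.1 - i.2.2)).natAbs : ℝ) ^ (ε / 2) ≤ C * (N:ℝ) ^ ε := by
        gcongr
      linarith
  refine (Finset.sum_le_sum hb).trans ?_
  rw [Finset.sum_add_distrib, Finset.sum_add_distrib]
  have s1 : ∑ i ∈ tri N, (if i.1 = i.2.2 then 2 * (N:ℝ) else 0) = 2 * (N:ℝ) ^ 3 := by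
    simp only [tri, Finset.sum_product]
    have : ∀ x ∈ Finset.Icc 1 N, ∑ y ∈ Finset.Icc 1 N, ∑ z ∈ Finset.Icc 1 N,
      (if x = z then 2 * (N:ℝ) else 0) = N * (2 * N) := by
      intro x hx
      simp only [Finset.sum_ite_eq, if_pos hx]; simp
    rw [Finset.sum_congr rfl this]; simp; ring
  have s2 : ∑ i ∈ tri N, (if i.2.1 = i.2.2 then 2 * (N:ℝ) else 0) = 2 * (N:ℝ) ^ 3 := by
    simp only [tri, Finset.sum_product]
    have : ∀ x ∈ Finset.Icc 1 N, ∑ y ∈ Finset.Icc 1 N, ∑ z ∈ Finset.Icc 1 N,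
      (if y = z then 2 * (N:ℝ) else 0) = N * (2 * N) := by
      intro x hx
      rw [Finset.sum_congr rfl (g := fun _ => 2 * (N:ℝ))
        (fun y hy => by simp only [Finset.sum_ite_eq, if_pos hy])]
      simp
    rw [Finset.sum_congr rfl this]; simp; ring
  rw [s1, s2, Finset.sum_const]
  have s3 : (tri N).card = N ^ 3 := by simp [tri]; ring
  rw [s3, Real.rpow_add (by positivity)]
  have e3 : (N:ℝ) ^ (3:ℝ) = (N:ℝ) ^ 3 := by exact_mod_cast Real.rpow_natCast (N:ℝ) 3
  rw [e3, nsmul_eq_mul]; push_cast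
  have : (N:ℝ) ^ 3 * 1 ≤ (N:ℝ) ^ 3 * (N:ℝ) ^ ε := by gcongr
  nlinarith

/-- truncated divisor function -/
def dQ (Q m : ℕ) : ℕ := ((Finset.Icc 1 Q).filter (fun q => q ∣ m)).card

lemma dQ_pow_le (Q m B : ℕ) :
    (dQ Q m) ^ B ≤ ∑ n ∈ (Finset.Icc 1 (Q ^ B)).filter (fun n => n ∣ m), n.divisors.card ^ B := by
  classical
  set s := (Finset.Icc 1 Q).filter (fun q => q ∣ m) with hs
  have hsm : ∀ q ∈ s, 1 ≤ q ∧ q ≤ Q ∧ q ∣ m := by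
    intro q hq; rw [hs, Finset.mem_filter, Finset.mem_Icc] at hq; exact ⟨hq.1.1, hq.1.2, hq.2⟩
  have h1 : (dQ Q m) ^ B = (Fintype.piFinset (fun _ : Fin B => s)).card := by
    simp [dQ, hs]
  rw [h1]
  have hmap : ∀ f ∈ Fintype.piFinset (fun _ : Fin B => s),
      Finset.univ.lcm f ∈ (Finset.Icc 1 (Q ^ B)).filter (fun n => n ∣ m) := by
    intro f hf
    rw [Fintype.mem_piFinset] at hf
    have hpp : 0 < ∏ i, f i := Finset.prod_pos fun i _ => (hsm _ (hf i)).1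
    have hd : Finset.univ.lcm f ∣ ∏ i, f i :=
      Finset.lcm_dvd fun i _ => Finset.dvd_prod_of_mem f (Finset.mem_univ i)
    rw [Finset.mem_filter, Finset.mem_Icc]
    refine ⟨⟨Nat.pos_of_dvd_of_pos hd hpp, (Nat.le_of_dvd hpp hd).trans ?_⟩,
      Finset.lcm_dvd fun i _ => (hsm _ (hf i)).2.2⟩
    calc ∏ i, f i ≤ ∏ i : Fin B, Q := Finset.prod_le_prod' fun i _ => (hsm _ (hf i)).2.1
      _ = Q ^ B := by simp
  rw [Finset.card_eq_sum_card_fiberwise hmap]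
  refine Finset.sum_le_sum fun n hn => ?_
  have hn0 : n ≠ 0 := by
    rw [Finset.mem_filter, Finset.mem_Icc] at hn; omega
  calc _ ≤ (Fintype.piFinset (fun _ : Fin B => n.divisors)).card := by
        refine Finset.card_le_card fun f hf => ?_
        rw [Finset.mem_filter] at hf
        rw [Fintype.mem_piFinset]
        intro i
        rw [Nat.mem_divisors]
        exact ⟨hf.2 ▸ Finset.dvd_lcm (Finset.mem_univ i), hn0⟩
    _ = _ := by simp

lemma dQ_moment (B : ℕ) (hB : 0 < B) : ∃ C : ℝ, 0 < C ∧ ∀ Q X : ℕ, 0 < Q →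
    ∑ m ∈ Finset.Icc 1 X, (dQ Q m : ℝ) ^ B ≤ C * Q * X := by
  have hBr : (0:ℝ) < B := by exact_mod_cast hB
  obtain ⟨C, hC1, hC⟩ := divisor_bound (1 / (2 * (B:ℝ) ^ 2)) (by positivity)
  refine ⟨C ^ B * (1 + 2 * B), by positivity, fun Q X hQ => ?_⟩
  have hQ1 : (1:ℝ) ≤ Q := by exact_mod_cast hQ
  have hsq : 1 ≤ √(Q:ℝ) := Real.one_le_sqrt.mpr hQ1
  calc ∑ m ∈ Finset.Icc 1 X, (dQ Q m : ℝ) ^ B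
      ≤ ∑ m ∈ Finset.Icc 1 X, ∑ n ∈ Finset.Icc 1 (Q ^ B),
          if n ∣ m then ((n.divisors.card : ℕ) : ℝ) ^ B else 0 := by
        refine Finset.sum_le_sum fun m _ => ?_
        rw [← Finset.sum_filter]
        exact_mod_cast dQ_pow_le Q m B
    _ = ∑ n ∈ Finset.Icc 1 (Q ^ B), ∑ m ∈ Finset.Icc 1 X,
          if n ∣ m then ((n.divisors.card : ℕ) : ℝ) ^ B else 0 := Finset.sum_comm
    _ ≤ ∑ n ∈ Finset.Icc 1 (Q ^ B), (C ^ B * √Q * X) * (n:ℝ)⁻¹ := by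
        refine Finset.sum_le_sum fun n hn => ?_
        rw [Finset.mem_Icc] at hn
        have hn1 : (0:ℝ) < n := by exact_mod_cast hn.1
        rw [← Finset.sum_filter, Finset.sum_const, nsmul_eq_mul]
        have hcard : ((Finset.Icc 1 X).filter (fun m => n ∣ m)).card = X / n := by
          have : (Finset.Icc 1 X) = Finset.Ioc 0 X := rfl
          rw [this, Nat.Ioc_filter_dvd_card_eq_div]
        rw [hcard]
        have h1 : ((X / n : ℕ) : ℝ) ≤ X * (n:ℝ)⁻¹ := by
          rw [← div_eq_mul_inv]; exact Nat.cast_div_le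
        have h2 : ((n.divisors.card : ℕ) : ℝ) ^ B ≤ C ^ B * √Q := by
          calc ((n.divisors.card : ℕ) : ℝ) ^ B ≤ (C * (n:ℝ) ^ (1 / (2 * (B:ℝ) ^ 2))) ^ B := by
                gcongr; exact hC n hn.1
            _ ≤ (C * ((Q:ℝ) ^ B) ^ (1 / (2 * (B:ℝ) ^ 2))) ^ B := by
                gcongr; exact_mod_cast hn.2
            _ = C ^ B * √Q := by
                rw [mul_pow, ← Real.rpow_natCast (Q:ℝ) B, ← Real.rpow_mul (by positivity),
                  ← Real.rpow_natCast (_ ^ _) B, ← Real.rpow_mul (by positivity), Real.sqrt_eq_rpow]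
                congr 2; field_simp
        calc ((X / n : ℕ) : ℝ) * ((n.divisors.card : ℕ) : ℝ) ^ B
            ≤ (X * (n:ℝ)⁻¹) * (C ^ B * √Q) := by gcongr
          _ = _ := by ring
    _ = (C ^ B * √Q * X) * (harmonic (Q ^ B) : ℝ) := by
        rw [← Finset.mul_sum, harmonic_eq_sum_Icc]; push_cast; rfl
    _ ≤ (C ^ B * √Q * X) * ((1 + 2 * B) * √Q) := by
        gcongr
        refine (harmonic_le_one_add_log _).trans ?_
        push_cast
        rw [Real.log_pow]
        have : Real.log Q ≤ 2 * √Q := by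
          have h := Real.log_le_sub_one_of_pos (show 0 < √(Q:ℝ) by positivity)
          rw [Real.log_sqrt (by positivity)] at h
          linarith
        nlinarith
    _ = C ^ B * (1 + 2 * B) * (√Q * √Q) * X := by ring
    _ = _ := by rw [Real.mul_self_sqrt (by positivity)]

/-- distance to the nearest integer -/
noncomputable def nd (u : ℝ) : ℝ := |u - round u|

lemma nd_nonneg (u : ℝ) : 0 ≤ nd u := abs_nonneg _

lemma nd_le (u : ℝ) (k : ℤ) : nd u ≤ |u - k| := round_le u k

lemma nd_eq (u w : ℝ) (k : ℤ) (h : u = k + w) (hw : |w| < 1 / 2) : nd u = |w| := by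
  have : round u = k := by
    rw [round_eq, h, Int.floor_eq_iff]
    rw [abs_lt] at hw
    constructor <;> linarith
  rw [nd, this, h]; congr 1; ring

lemma nd_add_int (u : ℝ) (k : ℤ) : nd (u + k) = nd u := by
  rw [nd, nd, round_add_intCast]; congr 1; push_cast; ring

lemma nd_sub_le (x y : ℝ) : nd x - |y - x| ≤ nd y := by
  have h1 := nd_le x (round y)
  have h2 : |x - round y| ≤ |x - y| + |y - round y| := abs_sub_le _ _ _
  rw [abs_sub_comm x y] at h2
  unfold nd at *
  linarith

lemma norm_ee_sub_one (u : ℝ) : 4 * nd u ≤ ‖ee u - 1‖ := by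
  set w := u - round u with hw
  have hw2 : |w| ≤ 1 / 2 := abs_sub_round u
  have h1 : ee u = ee w := by
    have : u = w + (round u : ℤ) := by rw [hw]; ring
    conv_lhs => rw [this]
    rw [ee_add, ee_int, mul_one]
  have h2 : ee w = Complex.exp (Complex.I * ((2 * Real.pi * w : ℝ))) := by
    rw [ee]; congr 1; push_cast; ring
  rw [h1, h2, Complex.norm_exp_I_mul_ofReal_sub_one]
  have h3 : (2 * Real.pi * w / 2) = Real.pi * w := by ring
  rw [h3, norm_mul, Real.norm_eq_abs, Real.norm_eq_abs, abs_of_pos (by norm_num : (0:ℝ) < 2)]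
  have hpi := Real.pi_pos
  have h4 : |Real.sin (Real.pi * w)| = Real.sin (Real.pi * |w|) := by
    rcases le_total 0 w with h | h
    · rw [abs_of_nonneg h] at hw2 ⊢
      rw [abs_of_nonneg (Real.sin_nonneg_of_nonneg_of_le_pi (by positivity) (by nlinarith))]
    · rw [abs_of_nonpos h] at hw2 ⊢
      rw [mul_neg, Real.sin_neg, abs_of_nonpos]
      have := Real.sin_nonneg_of_nonneg_of_le_pi (x := Real.pi * (-w)) (by nlinarith) (by nlinarith)
      rw [mul_neg, Real.sin_neg] at this
      linarith
  rw [h4]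
  have h5 := Real.mul_le_sin (x := Real.pi * |w|) (by positivity) (by nlinarith)
  have h6 : 2 / Real.pi * (Real.pi * |w|) = 2 * |w| := by field_simp
  have : nd u = |w| := rfl
  rw [this]; linarith

lemma geom_bound (N M : ℕ) (hM : M ≤ N) (u : ℝ) :
    ‖∑ n ∈ Finset.range M, ee (n * u)‖ ≤ 2 * N / (1 + 2 * N * nd u) := by
  have hn := nd_nonneg u
  have h1 : ‖∑ n ∈ Finset.range M, ee (n * u)‖ ≤ N := by
    refine (norm_sum_le _ _).trans ?_
    simp only [norm_ee, Finset.sum_const, Finset.card_range, nsmul_eq_mul, mul_one]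
    exact_mod_cast hM
  have h2 : ‖∑ n ∈ Finset.range M, ee (n * u)‖ * (4 * nd u) ≤ 2 := by
    calc _ ≤ ‖∑ n ∈ Finset.range M, ee (n * u)‖ * ‖ee u - 1‖ := by
          gcongr; exact norm_ee_sub_one u
      _ = ‖ee u ^ M - 1‖ := by
          simp only [ee_nat_mul]
          rw [← norm_mul, geom_sum_mul]
      _ ≤ ‖ee u ^ M‖ + ‖(1:ℂ)‖ := norm_sub_le _ _
      _ = 2 := by rw [norm_pow, norm_ee]; norm_num
  rw [le_div_iff₀ (by positivity)]
  have : (N:ℝ) * (‖∑ n ∈ Finset.range M, ee (n * u)‖ * (4 * nd u)) ≤ N * 2 := by gcongr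
  linarith

lemma sq_sum_expand (c : ℕ → ℂ) (hc : ∀ n, ‖c n‖ = 1) (N : ℕ) :
    ‖∑ n ∈ Finset.range N, c n‖ ^ 2 = -N + 2 * (∑ m ∈ Finset.range N,
      ∑ k ∈ Finset.range (m + 1), c m * (starRingEnd ℂ) (c k)).re := by
  induction N with
  | zero => simp
  | succ N ih =>
    rw [Finset.sum_range_succ, Finset.sum_range_succ (fun m => ∑ k ∈ Finset.range (m + 1),
      c m * (starRingEnd ℂ) (c k)), Finset.sum_range_succ (fun k => c N * (starRingEnd ℂ) (c k)),
      Complex.mul_conj', hc, ← Finset.mul_sum, ← map_sum]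
    set S := ∑ n ∈ Finset.range N, c n
    have h : ‖S + c N‖ ^ 2 = ‖S‖ ^ 2 + 1 + 2 * (c N * (starRingEnd ℂ) S).re := by
      rw [← Complex.normSq_eq_norm_sq, Complex.normSq_add, Complex.normSq_eq_norm_sq,
        Complex.normSq_eq_norm_sq, hc]
      simp only [Complex.mul_re, Complex.conj_re, Complex.conj_im]; ring
    rw [h, ih]
    simp only [Complex.add_re]
    push_cast
    simp
    ring

lemma weyl_step (N : ℕ) (x t : ℝ) : ‖VV N (fun _ => 1) (x, t)‖ ^ 2 ≤
    N + 2 * ∑ h ∈ Finset.Ico 1 N, 2 * N / (1 + 2 * N * nd (h * (2 * t))) := by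
  set c : ℕ → ℂ := fun n => ee ((n + 1) * x + ((n:ℝ) + 1) ^ 2 * t) with hc
  have h1 : VV N (fun _ => 1) (x, t) = ∑ n ∈ Finset.range N, c n := by
    unfold VV
    have : Finset.Icc 1 N = Finset.Ico 1 (N + 1) := rfl
    rw [this, Finset.sum_Ico_eq_sum_range]
    refine Finset.sum_congr (by simp) fun n _ => ?_
    rw [one_mul, hc]; dsimp only; congr 1; push_cast; ring
  rw [h1, sq_sum_expand c (fun n => norm_ee _)]
  have h2 : ∑ m ∈ Finset.range N, ∑ k ∈ Finset.range (m + 1), c m * (starRingEnd ℂ) (c k)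
      = ∑ h ∈ Finset.range N, ∑ n ∈ Finset.range (N - h), c (n + h) * (starRingEnd ℂ) (c n) := by
    rw [← Finset.sum_range_diag_flip N (fun h n => c (n + h) * (starRingEnd ℂ) (c n))]
    refine Finset.sum_congr rfl fun m _ => ?_
    rw [← Finset.sum_range_reflect]
    refine Finset.sum_congr rfl fun k hk => ?_
    rw [Finset.mem_range] at hk
    have e1 : m + 1 - 1 - k = m - k := by omega
    have e2 : m - k + k = m := by omega
    rw [e1, e2]
  have h3 : ∀ h, ‖∑ n ∈ Finset.range (N - h), c (n + h) * (starRingEnd ℂ) (c n)‖ ≤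
      2 * N / (1 + 2 * N * nd (h * (2 * t))) := by
    intro h
    have : ∀ n : ℕ, c (n + h) * (starRingEnd ℂ) (c n) =
      ee (h * x + ((h:ℝ) ^ 2 + 2 * h) * t) * ee (n * (h * (2 * t))) := by
      intro n
      rw [hc]; dsimp only
      rw [conj_ee, ← ee_add, ← ee_add]; congr 1; push_cast; ring
    simp only [this]
    rw [← Finset.mul_sum, norm_mul, norm_ee, one_mul]
    exact geom_bound N _ (Nat.sub_le _ _) _
  rcases Nat.eq_zero_or_pos N with h0 | hN
  · subst h0; simp
  rw [h2, Finset.range_eq_Ico, Finset.sum_eq_sum_Ico_succ_bot hN]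
  have h4 : (∑ n ∈ Finset.range (N - 0), c (n + 0) * (starRingEnd ℂ) (c n)) = N := by
    have : ∀ n, c (n + 0) * (starRingEnd ℂ) (c n) = 1 := by
      intro n; rw [add_zero, Complex.mul_conj', hc]; dsimp only; rw [norm_ee]; simp
    simp only [this]; simp
  rw [h4, Complex.add_re, Complex.natCast_re]
  have h5 : (∑ h ∈ Finset.Ico (0 + 1) N, ∑ n ∈ Finset.range (N - h),
      c (n + h) * (starRingEnd ℂ) (c n)).re ≤
      ∑ h ∈ Finset.Ico 1 N, 2 * N / (1 + 2 * N * nd (h * (2 * t))) := by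
    refine (Complex.re_le_norm _).trans ((norm_sum_le _ _).trans ?_)
    exact Finset.sum_le_sum fun h _ => h3 h
  linarith

lemma sum_block (f : ℕ → ℝ) (q : ℕ) (hf : ∀ n, f (n + q) = f n) (k : ℕ) :
    ∑ h ∈ Finset.range (q * k), f h = k * ∑ h ∈ Finset.range q, f h := by
  have hk : ∀ k n, f (q * k + n) = f n := by
    intro k; induction k with
    | zero => simp
    | succ k ih => intro n; rw [← ih n, ← hf (q * k + n)]; congr 1; ring
  induction k with
  | zero => simp
  | succ k ih =>
    rw [mul_add, mul_one, Finset.sum_range_add, ih]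
    simp only [hk]; push_cast; ring

lemma sum_inv_nd (q : ℕ) : ∑ c ∈ Finset.range q, (nd (c / q))⁻¹ ≤ 2 * q * (1 + Real.log q) := by
  have h1 : ∀ c ∈ Finset.range q, (nd (c / q))⁻¹ ≤ q * ((c:ℝ)⁻¹ + ((q:ℝ) - c)⁻¹) := by
    intro c hc
    rw [Finset.mem_range] at hc
    have hcq : (c:ℝ) < q := by exact_mod_cast hc
    have hq : (0:ℝ) < q := lt_of_le_of_lt (by positivity) hcq
    have hqc : 0 < (q:ℝ) - c := by linarith
    rcases Nat.eq_zero_or_pos c with h0 | hcp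
    · subst h0; simp [nd]; positivity
    have hcp' : (0:ℝ) < c := by exact_mod_cast hcp
    set k := round ((c:ℝ) / q) with hk
    have : nd (c / q) = |(c:ℝ) / q - k| := rfl
    rcases le_or_gt k 0 with h | h
    · have hk0 : (k:ℝ) ≤ 0 := by exact_mod_cast h
      have h2 : (c:ℝ) / q ≤ nd (c / q) := by
        rw [this]; refine le_trans ?_ (le_abs_self _); linarith
      calc (nd (c / q))⁻¹ ≤ ((c:ℝ) / q)⁻¹ := by gcongr
        _ = q * (c:ℝ)⁻¹ := by rw [inv_div]; rfl
        _ ≤ _ := by gcongr; linarith [inv_pos.mpr hqc]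
    · have hk0 : (1:ℝ) ≤ k := by exact_mod_cast h
      have h2 : ((q:ℝ) - c) / q ≤ nd (c / q) := by
        rw [this]; refine le_trans ?_ (neg_le_abs _); rw [sub_div, div_self hq.ne']; linarith
      calc (nd (c / q))⁻¹ ≤ (((q:ℝ) - c) / q)⁻¹ := by gcongr
        _ = q * ((q:ℝ) - c)⁻¹ := by rw [inv_div]; rfl
        _ ≤ _ := by gcongr; linarith [inv_pos.mpr hcp']
  refine (Finset.sum_le_sum h1).trans ?_
  rw [← Finset.mul_sum, Finset.sum_add_distrib]
  have hh : ((harmonic q : ℚ) : ℝ) = ∑ c ∈ Finset.range q, ((c:ℝ) + 1)⁻¹ := by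
    rw [harmonic]; push_cast; rfl
  have a1 : ∑ c ∈ Finset.range q, (c:ℝ)⁻¹ ≤ harmonic q := by
    have : ∑ c ∈ Finset.range q, (c:ℝ)⁻¹ ≤ ∑ c ∈ Finset.range (q + 1), (c:ℝ)⁻¹ :=
      Finset.sum_le_sum_of_subset_of_nonneg (by simp) (fun _ _ _ => by positivity)
    rw [Finset.sum_range_succ'] at this
    rw [hh]; simpa using this
  have a2 : ∑ c ∈ Finset.range q, ((q:ℝ) - c)⁻¹ = harmonic q := by
    rw [hh, ← Finset.sum_range_reflect]
    refine Finset.sum_congr rfl fun c hc => ?_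
    rw [Finset.mem_range] at hc
    congr 1
    have : ((q - 1 - c : ℕ) : ℝ) = q - 1 - c := by
      rw [Nat.cast_sub (by omega), Nat.cast_sub (by omega)]; simp
    rw [this]; ring
  rw [a2]
  have := harmonic_le_one_add_log q
  have : (q:ℝ) * (∑ c ∈ Finset.range q, (c:ℝ)⁻¹ + harmonic q) ≤ q * (2 * (1 + Real.log q)) := by
    gcongr; linarith
  linarith

lemma sum_inv_nd_mul (q : ℕ) (a : ℤ) (hq : 0 < q) (hco : IsCoprime a (q:ℤ)) :
    ∑ h ∈ Finset.range q, (nd (h * (a / q)))⁻¹ ≤ 2 * q * (1 + Real.log q) := by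
  refine le_trans ?_ (sum_inv_nd q)
  have hqz : (q:ℤ) ≠ 0 := by exact_mod_cast hq.ne'
  have hqr : (q:ℝ) ≠ 0 := by exact_mod_cast hq.ne'
  set σ : ℕ → ℕ := fun h => (((h:ℤ) * a) % q).toNat with hσ
  have hσc : ∀ h, ((σ h : ℕ) : ℤ) = ((h:ℤ) * a) % q := fun h =>
    Int.toNat_of_nonneg (Int.emod_nonneg _ hqz)
  have h1 : ∀ h : ℕ, (nd (h * (a / q)))⁻¹ = (nd ((σ h : ℕ) / q))⁻¹ := by
    intro h
    congr 1
    have e : ((h:ℝ) * (a / q)) = ((σ h : ℕ) : ℝ) / q + (((h:ℤ) * a / q : ℤ) : ℝ) := by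
      have := Int.emod_add_mul_ediv ((h:ℤ) * a) q
      rw [← hσc] at this
      have this' : ((σ h : ℕ) : ℝ) + q * (((h:ℤ) * a / q : ℤ) : ℝ) = h * a := by exact_mod_cast this
      field_simp
      linarith
    rw [e, nd_add_int]
  simp only [h1]
  have hinj : Set.InjOn σ (Finset.range q) := by
    intro h hh k hk hhk
    simp only [Finset.coe_range, Set.mem_Iio] at hh hk
    have e : ((h:ℤ) * a) % q = ((k:ℤ) * a) % q := by rw [← hσc, ← hσc, hhk]
    have d : (q:ℤ) ∣ ((h:ℤ) - k) * a := by
      have := Int.emod_emod_of_dvd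
      rw [sub_mul]; exact Int.ModEq.dvd (Int.ModEq.symm e)
    have d2 : (q:ℤ) ∣ (h:ℤ) - k := hco.symm.dvd_of_dvd_mul_right d
    have := Int.eq_zero_of_abs_lt_dvd d2 (by rw [abs_lt]; constructor <;> omega)
    omega
  rw [← Finset.sum_image (f := fun c : ℕ => (nd ((c:ℝ) / q))⁻¹) hinj]
  refine Finset.sum_le_sum_of_subset_of_nonneg ?_ (fun _ _ _ => inv_nonneg.mpr (nd_nonneg _))
  intro c hc
  rw [Finset.mem_image] at hc
  obtain ⟨h, _, rfl⟩ := hc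
  rw [Finset.mem_range]
  have := Int.emod_lt_of_pos ((h:ℤ) * a) (show (0:ℤ) < q by exact_mod_cast hq)
  rw [← hσc] at this
  exact_mod_cast this

lemma log_sum (c : ℝ) (hc : 0 ≤ c) (J : ℕ) :
    c * ∑ j ∈ Finset.Icc 1 J, 1 / (1 + c * (j:ℝ)) ≤ Real.log (1 + c * J) := by
  induction J with
  | zero => simp
  | succ J ih =>
    rw [Finset.sum_Icc_succ_top (by omega), mul_add]
    have h1 : (0:ℝ) < 1 + c * J := by positivity
    have h2 : (0:ℝ) < 1 + c * (J + 1 : ℕ) := by positivity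
    have h3 := Real.one_sub_inv_le_log_of_pos (div_pos h2 h1)
    rw [Real.log_div h2.ne' h1.ne', inv_div] at h3
    have h4 : c * (1 / (1 + c * ((J + 1 : ℕ):ℝ))) = 1 - (1 + c * J) / (1 + c * (J + 1 : ℕ)) := by
      rw [eq_sub_iff_add_eq, mul_one_div, ← add_div, div_eq_one_iff_eq h2.ne']; push_cast; ring
    rw [h4]; linarith

lemma weyl_dirichlet (N : ℕ) (hN : 0 < N) (u : ℝ) : ∃ q : ℕ, 0 < q ∧ q ≤ 2 * N ∧
    nd (q * u) ≤ 1 / (2 * N + 1) ∧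
    ∑ h ∈ Finset.Ico 1 N, 2 * N / (1 + 2 * N * nd (h * u)) ≤ 12 * N * (1 + Real.log (2 * N)) +
      2 * N * ∑ j ∈ Finset.Icc 1 (N / q), 1 / (1 + (2 * N * nd (q * u)) * (j:ℝ)) := by
  obtain ⟨r, hr1, hr2⟩ := Real.exists_rat_abs_sub_le_and_den_le u (show 0 < 2 * N by omega)
  set q := r.den with hq
  set a := r.num with ha
  have hq0 : 0 < q := r.den_pos
  have hqr : (0:ℝ) < q := by exact_mod_cast hq0
  have hNr : (0:ℝ) < N := by exact_mod_cast hN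
  have hrr : (r:ℝ) = a / q := by rw [hq, ha]; exact_mod_cast (Rat.num_div_den r).symm
  have hco : IsCoprime a (q:ℤ) := Rat.isCoprime_num_den r
  set β := u - r with hβ
  have hu : u = a / q + β := by rw [hβ, hrr]; ring
  push_cast at hr1
  have hb : |β| * q ≤ 1 / (2 * N + 1) := by
    have : |β| ≤ 1 / ((2 * N + 1) * q) := hr1
    calc |β| * q ≤ 1 / ((2 * N + 1) * q) * q := by gcongr
      _ = _ := by field_simp
  have hmul : ∀ j : ℕ, q * j ≤ N → nd ((q * j : ℕ) * u) = j * (|β| * q) := by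
    intro j hj
    have hj' : (q:ℝ) * j ≤ N := by exact_mod_cast hj
    have hjN : (j:ℝ) ≤ N := by
      have : j ≤ N := (Nat.le_mul_of_pos_left j hq0).trans hj
      exact_mod_cast this
    have e : |(j:ℝ) * q * β| = j * (|β| * q) := by
      rw [abs_mul, abs_of_nonneg (by positivity)]; ring
    rw [← e]
    refine nd_eq _ _ (j * a) ?_ ?_
    · rw [hu]; push_cast; field_simp
    · rw [e]
      calc j * (|β| * q) ≤ N * (1 / (2 * N + 1)) := by gcongr
        _ < 1 / 2 := by rw [mul_one_div, div_lt_div_iff₀ (by positivity) (by positivity)]; linarith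
  have hndq : nd (q * u) = |β| * q := by
    by_cases hqN : q ≤ N
    · have := hmul 1 (by simpa using hqN)
      simpa using this
    · have e : |(q:ℝ) * β| = |β| * q := by
        rw [abs_mul, abs_of_nonneg (by positivity)]; ring
      rw [← e]
      refine nd_eq _ _ a ?_ ?_
      · rw [hu]; field_simp
      · rw [e]; refine hb.trans_lt ?_
        rw [div_lt_div_iff₀ (by positivity) (by positivity)]
        have : (1:ℝ) ≤ N := by exact_mod_cast hN
        linarith
  refine ⟨q, hq0, hr2, hndq ▸ hb, ?_⟩
  have hterm : ∀ h ∈ Finset.Ico 1 N, 2 * N / (1 + 2 * N * nd (h * u)) ≤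
      2 * (nd (h * (a / q)))⁻¹ + (if q ∣ h then 2 * N / (1 + 2 * N * nd (h * u)) else 0) := by
    intro h hh
    rw [Finset.mem_Ico] at hh
    have hn0 := nd_nonneg (h * (a / q))
    split_ifs with hd
    · have : 0 ≤ (nd (h * (a / q)))⁻¹ := by positivity
      linarith
    · rw [add_zero]
      have hlow : 1 / q ≤ nd (h * (a / q)) := by
        set k := round ((h:ℝ) * (a / q))
        have e1 : nd (h * (a / q)) = |(((h:ℤ) * a - k * q : ℤ) : ℝ)| / q := by
          have : nd (h * (a / q)) = |(h:ℝ) * (a / q) - k| := rfl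
          rw [this, ← abs_of_pos hqr, ← abs_div, abs_of_pos hqr]
          congr 1; push_cast; field_simp
        rw [e1]
        gcongr
        have : ((h:ℤ) * a - k * q) ≠ 0 := by
          intro h0
          have : (q:ℤ) ∣ h * a := ⟨k, by linarith⟩
          have := hco.symm.dvd_of_dvd_mul_right this
          exact hd (by exact_mod_cast this)
        have := Int.one_le_abs this
        exact_mod_cast this
      have hdiff : |(h:ℝ) * u - h * (a / q)| ≤ 1 / 2 * (1 / q) := by
        have : (h:ℝ) * u - h * (a / q) = h * β := by rw [hu]; ring
        rw [this, abs_mul, abs_of_nonneg (by positivity : (0:ℝ) ≤ h)]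
        have hhN : (h:ℝ) ≤ N := by exact_mod_cast hh.2.le
        have hb2 : |β| ≤ 1 / (2 * N + 1) * (1 / q) := by
          rw [mul_one_div, le_div_iff₀ hqr]; exact hb
        calc (h:ℝ) * |β| ≤ N * (1 / (2 * N + 1) * (1 / q)) := by gcongr
          _ = (N * (1 / (2 * N + 1))) * (1 / q) := by ring
          _ ≤ _ := by
            gcongr
            rw [mul_one_div, div_le_div_iff₀ (by positivity) (by positivity)]; linarith
      have h3 := nd_sub_le (h * (a / q)) (h * u)
      have hpos : 0 < nd (h * (a / q)) := lt_of_lt_of_le (by positivity) hlow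
      have h4 : nd (h * (a / q)) / 2 ≤ nd (h * u) := by linarith
      have h5 : 0 < nd (h * u) := by linarith
      calc 2 * N / (1 + 2 * N * nd (h * u)) ≤ 2 * N / (2 * N * nd (h * u)) := by
            gcongr; linarith
        _ = (nd (h * u))⁻¹ := by field_simp
        _ ≤ (nd (h * (a / q)) / 2)⁻¹ := by gcongr
        _ = _ := by rw [inv_div]; rfl
  refine (Finset.sum_le_sum hterm).trans ?_
  rw [Finset.sum_add_distrib]
  gcongr ?_ + ?_
  · rw [← Finset.mul_sum]
    have hinvnn : ∀ h : ℕ, 0 ≤ (nd (h * (a / q)))⁻¹ := fun h => inv_nonneg.mpr (nd_nonneg _)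
    have s1 : ∑ h ∈ Finset.Ico 1 N, (nd (h * (a / q)))⁻¹ ≤
        ∑ h ∈ Finset.range (q * (N / q + 1)), (nd (h * (a / q)))⁻¹ := by
      refine Finset.sum_le_sum_of_subset_of_nonneg ?_ (fun h _ _ => hinvnn h)
      intro h hh
      rw [Finset.mem_Ico] at hh
      rw [Finset.mem_range]
      exact hh.2.trans (Nat.lt_mul_div_succ N hq0)
    rw [sum_block (fun h : ℕ => (nd (h * (a / q)))⁻¹) q] at s1
    · have s2 := sum_inv_nd_mul q a hq0 hco
      have hlogq : Real.log q ≤ Real.log (2 * N) := Real.log_le_log hqr (by exact_mod_cast hr2)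
      have hlog0 : 0 ≤ Real.log q := Real.log_natCast_nonneg q
      have hqN : (q:ℝ) ≤ 2 * N := by exact_mod_cast hr2
      calc 2 * ∑ h ∈ Finset.Ico 1 N, (nd (h * (a / q)))⁻¹
          ≤ 2 * (((N / q + 1 : ℕ) : ℝ) * (2 * q * (1 + Real.log q))) := by
            refine mul_le_mul_of_nonneg_left (s1.trans ?_) (by norm_num)
            gcongr
        _ ≤ 2 * (((N:ℝ) / q + 1) * (2 * q * (1 + Real.log q))) := by
            gcongr; push_cast; gcongr; exact Nat.cast_div_le
        _ = 4 * (N + q) * (1 + Real.log q) := by field_simp; ring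
        _ ≤ 4 * (N + 2 * N) * (1 + Real.log (2 * N)) := by gcongr
        _ = _ := by ring
    · intro n
      have : (((n + q : ℕ) : ℝ) * (a / q)) = n * (a / q) + (a:ℤ) := by push_cast; field_simp
      rw [this, nd_add_int]
  · rw [← Finset.sum_filter, Finset.mul_sum]
    have hsub : (Finset.Ico 1 N).filter (fun h => q ∣ h) ⊆
        (Finset.Icc 1 (N / q)).image (fun j => q * j) := by
      intro h hh
      rw [Finset.mem_filter, Finset.mem_Ico] at hh
      obtain ⟨⟨h1, h2⟩, j, rfl⟩ := hh
      rw [Finset.mem_image]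
      refine ⟨j, ?_, rfl⟩
      rw [Finset.mem_Icc]
      refine ⟨Nat.pos_of_mul_pos_left h1, ?_⟩
      rw [Nat.le_div_iff_mul_le hq0, mul_comm]; exact h2.le
    refine (Finset.sum_le_sum_of_subset_of_nonneg hsub (fun h _ _ => ?_)).trans ?_
    · have := nd_nonneg (h * u); positivity
    · rw [Finset.sum_image (fun x _ y _ h => Nat.eq_of_mul_eq_mul_left hq0 h)]
      refine Finset.sum_le_sum fun j hj => ?_
      rw [Finset.mem_Icc, Nat.le_div_iff_mul_le hq0, mul_comm] at hj
      rw [hmul j hj.2, hndq]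
      rw [mul_one_div]
      apply le_of_eq; congr 1; ring

/-- the Fejer-type square -/
noncomputable def GG (q k : ℕ) (t : ℝ) : ℝ := ‖∑ j ∈ Finset.range k, ee (j * (q * (2 * t)))‖ ^ 2

lemma GG_lower (q k : ℕ) (t : ℝ) (h : k * nd (q * (2 * t)) ≤ 1 / 8) :
    (k:ℝ) ^ 2 / 4 ≤ GG q k t := by
  set y : ℝ := q * (2 * t)
  set w := y - round y with hw
  have hz : nd y = |w| := rfl
  have h1 : (k:ℝ) / 2 ≤ (∑ j ∈ Finset.range k, ee (j * y)).re := by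
    rw [Complex.re_sum]
    have : ∀ j ∈ Finset.range k, (1:ℝ) / 2 ≤ (ee (j * y)).re := by
      intro j hj
      rw [Finset.mem_range] at hj
      have e1 : ee (j * y) = ee (j * w) := by
        have : (j:ℝ) * y = j * w + ((j * round y : ℤ) : ℝ) := by rw [hw]; push_cast; ring
        rw [this, ee_add, ee_int, mul_one]
      have e2 : (ee (j * w)).re = Real.cos (2 * Real.pi * (j * w)) := by
        rw [ee, ← Complex.exp_ofReal_mul_I_re]; congr 2; push_cast; ring
      rw [e1, e2]
      have hjw : |(j:ℝ) * w| ≤ 1 / 8 := by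
        rw [abs_mul, abs_of_nonneg (by positivity : (0:ℝ) ≤ j)]
        refine le_trans ?_ h
        rw [hz]; gcongr
      have hb := Real.one_sub_sq_div_two_le_cos (x := 2 * Real.pi * (j * w))
      have hsq : ((j:ℝ) * w) ^ 2 ≤ (1 / 8) ^ 2 := sq_le_sq' (by linarith [abs_le.mp hjw]) (by linarith [abs_le.mp hjw])
      have hpi : Real.pi ^ 2 ≤ 10 := by nlinarith [Real.pi_lt_d2, Real.pi_pos]
      have : (2 * Real.pi * (j * w)) ^ 2 = 4 * (Real.pi ^ 2 * (j * w) ^ 2) := by ring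
      have h6 : Real.pi ^ 2 * ((j:ℝ) * w) ^ 2 ≤ 10 * (1 / 8) ^ 2 := by gcongr
      norm_num at h6
      linarith
    have := Finset.sum_le_sum this
    simp only [Finset.sum_const, Finset.card_range, nsmul_eq_mul] at this
    linarith
  have h2 := h1.trans (Complex.re_le_norm _)
  unfold GG
  calc (k:ℝ) ^ 2 / 4 = (k / 2) ^ 2 := by ring
    _ ≤ _ := by gcongr

/-- the relevant dyadic scales -/
def II (N Y : ℕ) : Finset ℕ :=
  (Finset.range (N ^ 2 + 1)).filter fun i => N ^ 2 ≤ 2 ^ 18 * Y ^ 12 * 2 ^ i ∧ 2 ^ i ≤ N ^ 2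

lemma mem_II {N Y i : ℕ} : i ∈ II N Y ↔
    i < N ^ 2 + 1 ∧ N ^ 2 ≤ 2 ^ 18 * Y ^ 12 * 2 ^ i ∧ 2 ^ i ≤ N ^ 2 := by
  unfold II; rw [Finset.mem_filter, Finset.mem_range]

lemma II_card (N Y : ℕ) (hY : 0 < Y) : (II N Y).card ≤ Nat.log 2 (2 ^ 18 * Y ^ 12) + 1 := by
  rcases (II N Y).eq_empty_or_nonempty with h | h
  · rw [h]; simp
  set i0 := (II N Y).min' h
  have h0 := (II N Y).min'_mem h
  have hsub : II N Y ⊆ Finset.Icc i0 (i0 + Nat.log 2 (2 ^ 18 * Y ^ 12)) := by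
    intro i hi
    have hle := (II N Y).min'_le i hi
    rw [Finset.mem_Icc]
    refine ⟨hle, ?_⟩
    have hi := mem_II.mp hi
    have h0 := mem_II.mp h0
    have h1 : 2 ^ i ≤ 2 ^ 18 * Y ^ 12 * 2 ^ i0 := hi.2.2.trans h0.2.1
    have h2 : 2 ^ (i - i0) ≤ 2 ^ 18 * Y ^ 12 := by
      have : 2 ^ i = 2 ^ (i - i0) * 2 ^ i0 := by rw [← pow_add]; congr 1; omega
      rw [this] at h1
      exact Nat.le_of_mul_le_mul_right h1 (by positivity)
    have := Nat.le_log_of_pow_le (by norm_num) h2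
    omega
  refine (Finset.card_le_card hsub).trans ?_
  simp; omega

noncomputable def LL (Y : ℕ) : ℝ := 1 + Real.log (1 + 1024 * (Y:ℝ) ^ 8)

lemma weyl_scale (N Y q : ℕ) (z : ℝ) (hN : 4 ≤ N) (hY : 0 < Y) (hQN : 16 * Y ^ 4 ≤ N ^ 2)
    (hq0 : 0 < q) (hqQ : q ≤ 16 * Y ^ 4) (hz0 : 0 ≤ z) (hz1 : z ≤ 1 / (2 * N + 1)) (Sg S : ℝ)
    (hSg : Sg = ∑ j ∈ Finset.Icc 1 (N / q), 1 / (1 + (2 * N * z) * (j:ℝ)))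
    (hS : S = 4 * N * Sg) (hS1 : S ≤ 4 * N ^ 2 / q) (hSlow : (N:ℝ) ^ 2 / (4 * Y ^ 4) ≤ S)
    (hL1 : 1 ≤ LL Y) :
    ∃ i : ℕ, q * 2 ^ i ≤ N ^ 2 ∧ ((2 ^ i : ℕ) : ℝ) * z ≤ 1 / 8 ∧
      S ≤ 32 * (2:ℝ) ^ i * LL Y := by
  have hNr : (4:ℝ) ≤ N := by exact_mod_cast hN
  have hYr : (1:ℝ) ≤ Y := by exact_mod_cast hY
  have hqr : (0:ℝ) < q := by exact_mod_cast hq0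
  set J := N / q with hJ
  by_cases hc : 8 * z * N ^ 2 ≤ q
  · set M := N ^ 2 / q with hM
    have hM1 : M ≠ 0 := (Nat.div_pos (hqQ.trans hQN) hq0).ne'
    refine ⟨Nat.log 2 M, ?_, ?_, ?_⟩
    · calc q * 2 ^ Nat.log 2 M ≤ q * M := by gcongr; exact Nat.pow_log_le_self 2 hM1
        _ ≤ N ^ 2 := Nat.mul_div_le _ _
    · have h1 : ((2 ^ Nat.log 2 M : ℕ) : ℝ) ≤ (N:ℝ) ^ 2 / q := by
        have : ((2 ^ Nat.log 2 M : ℕ) : ℝ) ≤ M := by exact_mod_cast Nat.pow_log_le_self 2 hM1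
        refine this.trans ?_
        have := Nat.cast_div_le (α := ℝ) (m := N ^ 2) (n := q)
        push_cast at this
        exact this
      calc ((2 ^ Nat.log 2 M : ℕ) : ℝ) * z ≤ (N:ℝ) ^ 2 / q * z := by gcongr
        _ ≤ 1 / 8 := by
          rw [div_mul_eq_mul_div, div_le_div_iff₀ hqr (by norm_num)]; linarith
    · have h1 : N ^ 2 < q * (M + 1) := Nat.lt_mul_div_succ _ hq0
      have h2 : M + 1 ≤ 2 ^ (Nat.log 2 M + 1) := Nat.lt_pow_succ_log_self (by norm_num) M
      have h3 : N ^ 2 ≤ q * 2 ^ (Nat.log 2 M + 1) := h1.le.trans (by gcongr)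
      have h4 : (N:ℝ) ^ 2 ≤ q * (2:ℝ) ^ (Nat.log 2 M + 1) := by exact_mod_cast h3
      rw [pow_succ (2:ℝ)] at h4
      have h5 : S ≤ 8 * (2:ℝ) ^ (Nat.log 2 M) := by
        refine hS1.trans ?_
        rw [div_le_iff₀ hqr]; linarith
      have h6 : (0:ℝ) < (2:ℝ) ^ (Nat.log 2 M) := by positivity
      nlinarith
  · push Not at hc
    have hzp : 0 < z := by
      by_contra h
      have : z = 0 := le_antisymm (not_lt.mp h) hz0
      rw [this] at hc; simp at hc; linarith
    set M := ⌊1 / (8 * z)⌋₊ with hM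
    have hz8 : z ≤ 1 / 8 := hz1.trans (by gcongr; linarith)
    have hM1 : M ≠ 0 := by
      have : 1 ≤ M := Nat.le_floor (by
        rw [le_div_iff₀ (by positivity)]; push_cast; linarith)
      omega
    have hkM : ((2 ^ Nat.log 2 M : ℕ) : ℝ) ≤ 1 / (8 * z) := by
      have : ((2 ^ Nat.log 2 M : ℕ) : ℝ) ≤ M := by exact_mod_cast Nat.pow_log_le_self 2 hM1
      exact this.trans (Nat.floor_le (by positivity))
    refine ⟨Nat.log 2 M, ?_, ?_, ?_⟩
    · have : (q:ℝ) * ((2 ^ Nat.log 2 M : ℕ) : ℝ) ≤ N ^ 2 := by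
        calc (q:ℝ) * ((2 ^ Nat.log 2 M : ℕ) : ℝ) ≤ (8 * z * N ^ 2) * (1 / (8 * z)) := by
              gcongr
          _ = N ^ 2 := by field_simp
      exact_mod_cast this
    · calc ((2 ^ Nat.log 2 M : ℕ) : ℝ) * z ≤ 1 / (8 * z) * z := by gcongr
        _ = 1 / 8 := by field_simp
    · have h1 : 1 / (8 * z) < M + 1 := Nat.lt_floor_add_one _
      have h2 : M + 1 ≤ 2 ^ (Nat.log 2 M + 1) := Nat.lt_pow_succ_log_self (by norm_num) M
      have h2' : (M:ℝ) + 1 ≤ (2:ℝ) ^ (Nat.log 2 M + 1) := by exact_mod_cast h2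
      have h3 : 1 / (8 * z) ≤ 2 * (2:ℝ) ^ (Nat.log 2 M) := by rw [pow_succ] at h2'; linarith
      set c := 2 * N * z with hcdef
      have hcp : 0 < c := by positivity
      have hlog := log_sum c hcp.le J
      rw [← hSg] at hlog
      set w := c * J with hwdef
      have hw0 : 0 ≤ w := by positivity
      have hwN : w ≤ 16 * Y ^ 4 * Real.log (1 + w) := by
        have hJN : (J:ℝ) ≤ N := by
          have : J ≤ N := Nat.div_le_self _ _
          exact_mod_cast this
        have e1 : c * ((N:ℝ) ^ 2 / (4 * Y ^ 4)) ≤ 4 * N * Real.log (1 + w) := by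
          calc c * ((N:ℝ) ^ 2 / (4 * Y ^ 4)) ≤ c * S := by gcongr
            _ = 4 * N * (c * Sg) := by rw [hS]; ring
            _ ≤ _ := by gcongr
        have e2 : c * ((N:ℝ) ^ 2 / (4 * Y ^ 4)) = (c * N) * (N / (4 * Y ^ 4)) := by ring
        rw [e2, mul_div_assoc', div_le_iff₀ (by positivity)] at e1
        have e3 : (N:ℝ) * (c * N) ≤ N * (16 * Y ^ 4 * Real.log (1 + w)) := by linarith
        have e4 := le_of_mul_le_mul_left e3 (by linarith)
        refine le_trans ?_ e4
        rw [hwdef]; gcongr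
      have hlogw : Real.log (1 + w) ≤ 2 * √w := by
        have h := Real.log_le_sub_one_of_pos (show 0 < √(1 + w) by positivity)
        rw [Real.log_sqrt (by positivity)] at h
        have : √(1 + w) ≤ 1 + √w := by
          rw [Real.sqrt_le_left (by positivity)]
          nlinarith [Real.sq_sqrt hw0, Real.sqrt_nonneg w]
        linarith
      have hw8 : w ≤ 1024 * (Y:ℝ) ^ 8 := by
        have e1 : √w * √w ≤ 32 * Y ^ 4 * √w := by
          rw [Real.mul_self_sqrt hw0]
          refine hwN.trans ?_
          calc 16 * (Y:ℝ) ^ 4 * Real.log (1 + w) ≤ 16 * Y ^ 4 * (2 * √w) := by gcongr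
            _ = _ := by ring
        have e2 : √w ≤ 32 * Y ^ 4 := by
          rcases (Real.sqrt_nonneg w).eq_or_lt with h | h
          · rw [← h]; positivity
          · exact le_of_mul_le_mul_right e1 h
        calc w = √w ^ 2 := (Real.sq_sqrt hw0).symm
          _ ≤ (32 * Y ^ 4) ^ 2 := by gcongr
          _ = _ := by ring
      have hlogL : Real.log (1 + w) ≤ LL Y := by
        unfold LL
        have : Real.log (1 + w) ≤ Real.log (1 + 1024 * (Y:ℝ) ^ 8) :=
          Real.log_le_log (by positivity) (by linarith)
        linarith
      calc S = 16 * (1 / (8 * z)) * (c * Sg) := by rw [hS, hcdef]; field_simp; ring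
        _ ≤ 16 * (2 * (2:ℝ) ^ (Nat.log 2 M)) * LL Y := by
            have : 0 ≤ Real.log (1 + w) := Real.log_nonneg (by linarith)
            calc _ ≤ 16 * (1 / (8 * z)) * LL Y := by gcongr; exact hlog.trans hlogL
              _ ≤ _ := by gcongr
        _ = _ := by ring

lemma weyl_pointwise (N Y : ℕ) (hN : 4 ≤ N) (hY : 0 < Y) (hQN : 16 * Y ^ 4 ≤ N ^ 2)
    (hrem : N + 24 * N * (1 + Real.log (2 * N)) ≤ (N:ℝ) ^ 2 / (4 * Y ^ 4)) (x t : ℝ) :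
    ‖VV N (fun _ => 1) (x, t)‖ ^ 2 ≤ (N:ℝ) ^ 2 / (2 * Y ^ 4) + 256 * LL Y *
      ∑ q ∈ Finset.Icc 1 (16 * Y ^ 4), ∑ i ∈ II N Y,
        if q * 2 ^ i ≤ N ^ 2 then GG q (2 ^ i) t / 2 ^ i else 0 := by
  have hNr : (4:ℝ) ≤ N := by exact_mod_cast hN
  have hYr : (1:ℝ) ≤ Y := by exact_mod_cast hY
  have hL1 : 1 ≤ LL Y := by
    unfold LL
    have : 0 ≤ Real.log (1 + 1024 * (Y:ℝ) ^ 8) := Real.log_nonneg (by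
      have : (0:ℝ) ≤ 1024 * (Y:ℝ) ^ 8 := by positivity
      linarith)
    linarith
  have hGG0 : ∀ q k t, 0 ≤ GG q k t := fun q k t => by unfold GG; positivity
  have hterm0 : ∀ q i, 0 ≤ (if q * 2 ^ i ≤ N ^ 2 then GG q (2 ^ i) t / 2 ^ i else 0) := by
    intro q i; split_ifs
    · have := hGG0 q (2 ^ i) t; positivity
    · exact le_rfl
  by_cases hbad : ‖VV N (fun _ => 1) (x, t)‖ ^ 2 ≤ (N:ℝ) ^ 2 / (2 * Y ^ 4)
  · refine hbad.trans (le_add_of_nonneg_right ?_)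
    exact mul_nonneg (by positivity) (Finset.sum_nonneg fun q _ => Finset.sum_nonneg fun i _ => hterm0 q i)
  push Not at hbad
  obtain ⟨q, hq0, hq2, hz1, hsum⟩ := weyl_dirichlet N (by omega) (2 * t)
  have hw := weyl_step N x t
  set z := nd (q * (2 * t)) with hz
  have hz0 : 0 ≤ z := nd_nonneg _
  set J := N / q with hJ
  set Sg := ∑ j ∈ Finset.Icc 1 J, 1 / (1 + (2 * N * z) * (j:ℝ)) with hSg
  have hqr : (0:ℝ) < q := by exact_mod_cast hq0
  have hSJ : Sg ≤ J := by
    calc Sg ≤ ∑ j ∈ Finset.Icc 1 J, (1:ℝ) := by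
          refine Finset.sum_le_sum fun j _ => ?_
          rw [div_le_one (by positivity)]
          have : 0 ≤ (2 * N * z) * (j:ℝ) := by positivity
          linarith
      _ = J := by simp
  have hJr : (J:ℝ) ≤ N / q := Nat.cast_div_le
  set S := 4 * N * Sg with hS
  have hK : ‖VV N (fun _ => 1) (x, t)‖ ^ 2 ≤ (N:ℝ) ^ 2 / (4 * Y ^ 4) + S := by
    rw [hS]; linarith
  have hhalf : (N:ℝ) ^ 2 / (2 * Y ^ 4) = 2 * ((N:ℝ) ^ 2 / (4 * Y ^ 4)) := by field_simp; norm_num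
  have hSlow : (N:ℝ) ^ 2 / (4 * Y ^ 4) ≤ S := by linarith
  have hK2 : ‖VV N (fun _ => 1) (x, t)‖ ^ 2 ≤ 2 * S := by linarith
  have hS1 : S ≤ 4 * N ^ 2 / q := by
    calc S ≤ 4 * N * (N / q) := by rw [hS]; gcongr; linarith
      _ = _ := by ring
  have hqQ : q ≤ 16 * Y ^ 4 := by
    have : (N:ℝ) ^ 2 / (4 * Y ^ 4) ≤ 4 * N ^ 2 / q := hSlow.trans hS1
    rw [div_le_div_iff₀ (by positivity) hqr] at this
    have h2 : (N:ℝ) ^ 2 * q ≤ N ^ 2 * (16 * Y ^ 4) := by linarith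
    have h3 : (q:ℝ) ≤ 16 * Y ^ 4 := le_of_mul_le_mul_left h2 (by positivity)
    exact_mod_cast h3
  -- existence of the scale
  have hex := weyl_scale N Y q z hN hY hQN hq0 hqQ hz0 hz1 Sg S hSg hS hS1 hSlow hL1
  obtain ⟨i, hi1, hi2, hi3⟩ := hex
  have hiI : i ∈ II N Y := by
    have hle : 2 ^ i ≤ N ^ 2 := (Nat.le_mul_of_pos_left _ hq0).trans hi1
    refine mem_II.mpr ⟨?_, ?_, hle⟩
    · have : i < 2 ^ i := Nat.lt_two_pow_self
      omega
    · have h1 : (N:ℝ) ^ 2 / (4 * Y ^ 4) ≤ 32 * (2:ℝ) ^ i * LL Y := hSlow.trans hi3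
      have h2 : LL Y ≤ 2048 * (Y:ℝ) ^ 8 := by
        unfold LL
        have := Real.log_le_sub_one_of_pos (show 0 < 1 + 1024 * (Y:ℝ) ^ 8 by positivity)
        have : (1:ℝ) ≤ (Y:ℝ) ^ 8 := one_le_pow₀ hYr
        linarith
      rw [div_le_iff₀ (by positivity)] at h1
      have h3 : (N:ℝ) ^ 2 ≤ 2 ^ 18 * (Y:ℝ) ^ 12 * 2 ^ i := by
        refine h1.trans ?_
        calc 32 * (2:ℝ) ^ i * LL Y * (4 * Y ^ 4) ≤ 32 * (2:ℝ) ^ i * (2048 * (Y:ℝ) ^ 8) * (4 * Y ^ 4) := by gcongr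
          _ = _ := by ring
      exact_mod_cast h3
  have hG := GG_lower q (2 ^ i) t hi2
  have hterm : (2:ℝ) ^ i / 4 ≤ GG q (2 ^ i) t / 2 ^ i := by
    push_cast at hG
    rw [le_div_iff₀ (by positivity)]
    calc (2:ℝ) ^ i / 4 * 2 ^ i = (2 ^ i) ^ 2 / 4 := by ring
      _ ≤ _ := hG
  have hbig : (2:ℝ) ^ i / 4 ≤ ∑ q ∈ Finset.Icc 1 (16 * Y ^ 4), ∑ i ∈ II N Y,
        if q * 2 ^ i ≤ N ^ 2 then GG q (2 ^ i) t / 2 ^ i else 0 := by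
    calc (2:ℝ) ^ i / 4 ≤ if q * 2 ^ i ≤ N ^ 2 then GG q (2 ^ i) t / 2 ^ i else 0 := by
          rw [if_pos hi1]; exact hterm
      _ ≤ ∑ i ∈ II N Y, if q * 2 ^ i ≤ N ^ 2 then GG q (2 ^ i) t / 2 ^ i else 0 :=
          Finset.single_le_sum (f := fun i => if q * 2 ^ i ≤ N ^ 2 then GG q (2 ^ i) t / 2 ^ i else 0)
            (fun i _ => hterm0 q i) hiI
      _ ≤ _ := Finset.single_le_sum (f := fun q => ∑ i ∈ II N Y,
            if q * 2 ^ i ≤ N ^ 2 then GG q (2 ^ i) t / 2 ^ i else 0)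
            (fun q _ => Finset.sum_nonneg fun i _ => hterm0 q i)
            (Finset.mem_Icc.mpr ⟨hq0, hqQ⟩)
  have hpos : (0:ℝ) ≤ (N:ℝ) ^ 2 / (2 * Y ^ 4) := by positivity
  have : 256 * LL Y * ((2:ℝ) ^ i / 4) ≤ 256 * LL Y * ∑ q ∈ Finset.Icc 1 (16 * Y ^ 4), ∑ i ∈ II N Y,
        if q * 2 ^ i ≤ N ^ 2 then GG q (2 ^ i) t / 2 ^ i else 0 := by gcongr
  linarith

lemma prod_herm (E : Set (ℝ × ℝ)) (f : ℝ × ℝ → ℂ) :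
    ∫ z in E ×ˢ E, f z.1 * (starRingEnd ℂ) (f z.2) = ((‖∫ α in E, f α‖ ^ 2 : ℝ) : ℂ) := by
  rw [Measure.volume_eq_prod (ℝ × ℝ) (ℝ × ℝ), setIntegral_prod_mul f (fun x => (starRingEnd ℂ) (f x)), integral_conj,
    Complex.mul_conj']
  push_cast; rfl

lemma vol_prod_E (E : Set (ℝ × ℝ)) :
    (volume : Measure ((ℝ × ℝ) × (ℝ × ℝ))).real (E ×ˢ E) = volume.real E ^ 2 := by
  rw [Measure.volume_eq_prod (ℝ × ℝ) (ℝ × ℝ), measureReal_prod_prod, sq]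

/-- first duality step -/
lemma dual_step (N : ℕ) (g : ℕ → ℂ) (hg : ∀ n, ‖g n‖ ≤ 1) (E : Set (ℝ × ℝ))
    (hE : IsCompact E) (c : ℝ) (hc : 0 < c) (hEc : ∀ α ∈ E, c ≤ ‖VV N g α‖) :
    (c * volume.real E) ^ 2 ≤ N * ∫ z in E ×ˢ E, ‖VV N (fun _ => 1) (z.1 - z.2)‖ := by
  set σ : ℝ × ℝ → ℂ := fun α => (starRingEnd ℂ) (VV N g α) / ((max ‖VV N g α‖ c : ℝ) : ℂ) with hσ
  have hVc := continuous_VV N g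
  have hmax : ∀ α, 0 < max ‖VV N g α‖ c := fun α => lt_max_of_lt_right hc
  have hσc : Continuous σ := by
    refine Continuous.div (Complex.continuous_conj.comp hVc)
      (Complex.continuous_ofReal.comp (hVc.norm.max continuous_const)) fun α => ?_
    exact_mod_cast (hmax α).ne'
  have hσ1 : ∀ α, ‖σ α‖ ≤ 1 := by
    intro α
    rw [hσ]
    simp only [norm_div, RCLike.norm_conj, Complex.norm_real, Real.norm_eq_abs, abs_of_pos (hmax α)]
    rw [div_le_one (hmax α)]; exact le_max_left _ _
  set en : ℕ → ℝ × ℝ → ℂ := fun n α => σ α * ee (n * α.1 + (n:ℝ) ^ 2 * α.2) with hen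
  have henc : ∀ n, Continuous (en n) := fun n =>
    hσc.mul (continuous_ee.comp (by fun_prop))
  have hEm : MeasurableSet E := hE.measurableSet
  have h1 : ((∫ α in E, ‖VV N g α‖ : ℝ) : ℂ) = ∑ n ∈ Finset.Icc 1 N, g n * ∫ α in E, en n α := by
    rw [← integral_complex_ofReal]
    have : ∀ α ∈ E, ((‖VV N g α‖ : ℝ) : ℂ) = ∑ n ∈ Finset.Icc 1 N, g n * en n α := by
      intro α hα
      have e1 : ∑ n ∈ Finset.Icc 1 N, g n * en n α = σ α * VV N g α := by
        rw [VV, Finset.mul_sum]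
        exact Finset.sum_congr rfl fun n _ => by rw [hen]; ring
      have hp : ((‖VV N g α‖ : ℝ) : ℂ) ≠ 0 := by
        exact_mod_cast (hc.trans_le (hEc α hα)).ne'
      rw [e1, hσ]
      simp only [max_eq_left (hEc α hα)]
      rw [div_mul_eq_mul_div, Complex.conj_mul', sq, mul_div_assoc, div_self hp, mul_one]
    rw [setIntegral_congr_fun hEm this, integral_finsetSum]
    · simp_rw [integral_const_mul]
    · intro n _
      exact ((continuous_const.mul (henc n)).continuousOn.integrableOn_compact hE)
  have h2 : c * volume.real E ≤ ∫ α in E, ‖VV N g α‖ := by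
    have : ∫ α in E, c = c * volume.real E := by simp [mul_comm]
    rw [← this]
    refine setIntegral_mono_on ?_ ?_ hEm hEc
    · exact continuous_const.continuousOn.integrableOn_compact hE
    · exact hVc.norm.continuousOn.integrableOn_compact hE
  have h3 : (∫ α in E, ‖VV N g α‖) ≤ ∑ n ∈ Finset.Icc 1 N, ‖∫ α in E, en n α‖ := by
    have h0 : 0 ≤ ∫ α in E, ‖VV N g α‖ := integral_nonneg fun _ => norm_nonneg _
    have : ‖((∫ α in E, ‖VV N g α‖ : ℝ) : ℂ)‖ = ∫ α in E, ‖VV N g α‖ := by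
      rw [Complex.norm_real, Real.norm_eq_abs, abs_of_nonneg h0]
    rw [← this, h1]
    refine (norm_sum_le _ _).trans (Finset.sum_le_sum fun n _ => ?_)
    rw [norm_mul]
    exact mul_le_of_le_one_left (norm_nonneg _) (hg n)
  have h4 : (∑ n ∈ Finset.Icc 1 N, ‖∫ α in E, en n α‖) ^ 2 ≤
      N * ∑ n ∈ Finset.Icc 1 N, ‖∫ α in E, en n α‖ ^ 2 := by
    have := sq_sum_le_card_mul_sum_sq (s := Finset.Icc 1 N) (f := fun n => ‖∫ α in E, en n α‖)
    simpa using this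
  have hEE : IsCompact (E ×ˢ E) := hE.prod hE
  have h5 : ∑ n ∈ Finset.Icc 1 N, ‖∫ α in E, en n α‖ ^ 2 ≤
      ∫ z in E ×ˢ E, ‖VV N (fun _ => 1) (z.1 - z.2)‖ := by
    have e1 : ((∑ n ∈ Finset.Icc 1 N, ‖∫ α in E, en n α‖ ^ 2 : ℝ) : ℂ) =
        ∫ z in E ×ˢ E, σ z.1 * (starRingEnd ℂ) (σ z.2) * VV N (fun _ => 1) (z.1 - z.2) := by
      rw [Complex.ofReal_sum]
      simp_rw [← prod_herm]
      rw [← integral_finsetSum]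
      · congr 1; ext z
        rw [VV, Finset.mul_sum]
        refine Finset.sum_congr rfl fun n _ => ?_
        rw [hen]
        simp only [map_mul, conj_ee, Prod.fst_sub, Prod.snd_sub, one_mul]
        have : (n * (z.1.1 - z.2.1) + (n:ℝ) ^ 2 * (z.1.2 - z.2.2)) =
          (n * z.1.1 + (n:ℝ) ^ 2 * z.1.2) + -(n * z.2.1 + (n:ℝ) ^ 2 * z.2.2) := by ring
        rw [this, ee_add (n * z.1.1 + (n:ℝ) ^ 2 * z.1.2)]; ring
      · intro n _
        have hcc := ((henc n).comp continuous_fst).mul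
          (Complex.continuous_conj.comp ((henc n).comp continuous_snd))
        exact hcc.continuousOn.integrableOn_compact hEE
    have e2 : 0 ≤ ∑ n ∈ Finset.Icc 1 N, ‖∫ α in E, en n α‖ ^ 2 := by positivity
    have e3 : ‖((∑ n ∈ Finset.Icc 1 N, ‖∫ α in E, en n α‖ ^ 2 : ℝ) : ℂ)‖ =
        ∑ n ∈ Finset.Icc 1 N, ‖∫ α in E, en n α‖ ^ 2 := by
      rw [Complex.norm_real, Real.norm_eq_abs, abs_of_nonneg e2]
    rw [← e3, e1]
    refine norm_integral_le_of_norm_le ?_ (Filter.Eventually.of_forall fun z => ?_)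
    · have : Continuous fun z : (ℝ × ℝ) × (ℝ × ℝ) => ‖VV N (fun _ => 1) (z.1 - z.2)‖ :=
        ((continuous_VV N _).comp (continuous_fst.sub continuous_snd)).norm
      exact this.continuousOn.integrableOn_compact hEE
    · rw [norm_mul, norm_mul, RCLike.norm_conj]
      refine mul_le_of_le_one_left (norm_nonneg _) ?_
      exact mul_le_one₀ (hσ1 _) (norm_nonneg _) (hσ1 _)
  calc (c * volume.real E) ^ 2 ≤ (∑ n ∈ Finset.Icc 1 N, ‖∫ α in E, en n α‖) ^ 2 := by
        have : 0 ≤ c * volume.real E := by positivity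
        exact pow_le_pow_left₀ this (h2.trans h3) 2
    _ ≤ _ := h4.trans (by gcongr)

/-- Fourier coefficients in the second variable -/
noncomputable def eh (E : Set (ℝ × ℝ)) (l : ℤ) : ℝ := ‖∫ α in E, ee (l * α.2)‖ ^ 2

lemma eh_nonneg (E l) : 0 ≤ eh E l := by unfold eh; positivity

lemma eh_neg (E : Set (ℝ × ℝ)) (l : ℤ) : eh E (-l) = eh E l := by
  unfold eh
  have : ∀ α : ℝ × ℝ, ee ((-l : ℤ) * α.2) = (starRingEnd ℂ) (ee (l * α.2)) := by
    intro α; rw [conj_ee]; congr 1; push_cast; ring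
  simp_rw [this]
  rw [integral_conj, RCLike.norm_conj]

lemma eh_le (E : Set (ℝ × ℝ)) (hE : IsCompact E) (l : ℤ) : eh E l ≤ volume.real E ^ 2 := by
  unfold eh
  have := norm_setIntegral_le_of_norm_le_const (μ := volume) (s := E) (C := 1) (f := fun α : ℝ × ℝ => ee (l * α.2))
    hE.measure_lt_top (fun α _ => (norm_ee _).le)
  rw [one_mul] at this
  gcongr

lemma toeplitz_sum (f : ℤ → ℝ) (hf : ∀ l, 0 ≤ f l) (hn : ∀ l, f (-l) = f l) (k : ℕ) :
    ∑ i ∈ Finset.range k, ∑ j ∈ Finset.range k, f (i - j) ≤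
      k * (f 0 + 2 * ∑ l ∈ Finset.Ico 1 k, f l) := by
  have h : ∀ i ∈ Finset.range k, ∑ j ∈ Finset.range k, f (i - j) ≤
      f 0 + 2 * ∑ l ∈ Finset.Ico 1 k, f l := by
    intro i hi
    rw [Finset.mem_range] at hi
    have h1 : ∑ j ∈ Finset.range k, f (i - j) = f 0 + ∑ j ∈ (Finset.range k).erase i, f (i - j) := by
      rw [← Finset.add_sum_erase _ _ (Finset.mem_range.mpr hi)]; simp
    rw [h1, ← Finset.sum_filter_add_sum_filter_not _ (fun j => j < i), two_mul]
    gcongr f 0 + (?_ + ?_)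
    · have e : ∑ j ∈ ((Finset.range k).erase i).filter (fun j => j < i), f (i - j) =
          ∑ l ∈ (((Finset.range k).erase i).filter (fun j => j < i)).image (fun j => i - j), f l := by
        rw [Finset.sum_image]
        · refine Finset.sum_congr rfl fun j hj => ?_
          rw [Finset.mem_filter] at hj
          congr 1; omega
        · intro a ha b hb hab
          simp only [Finset.coe_filter, Set.mem_ofPred_eq] at ha hb hab
          omega
      rw [e]
      refine Finset.sum_le_sum_of_subset_of_nonneg ?_ (fun l _ _ => hf l)
      intro l hl
      simp only [Finset.mem_image, Finset.mem_filter, Finset.mem_erase, Finset.mem_range] at hl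
      rw [Finset.mem_Ico]; obtain ⟨j, hj, rfl⟩ := hl; omega
    · have e : ∑ j ∈ ((Finset.range k).erase i).filter (fun j => ¬ j < i), f (i - j) =
          ∑ l ∈ (((Finset.range k).erase i).filter (fun j => ¬ j < i)).image (fun j => j - i), f l := by
        rw [Finset.sum_image]
        · refine Finset.sum_congr rfl fun j hj => ?_
          rw [Finset.mem_filter] at hj
          rw [← hn]; congr 1; omega
        · intro a ha b hb hab
          simp only [Finset.coe_filter, Set.mem_ofPred_eq] at ha hb hab
          omega
      rw [e]
      refine Finset.sum_le_sum_of_subset_of_nonneg ?_ (fun l _ _ => hf l)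
      intro l hl
      simp only [Finset.mem_image, Finset.mem_filter, Finset.mem_erase, Finset.mem_range] at hl
      rw [Finset.mem_Ico]; obtain ⟨j, hj, rfl⟩ := hl; omega
  refine (Finset.sum_le_sum h).trans ?_
  simp [mul_add]

lemma continuous_GG (q k : ℕ) : Continuous (GG q k) := by
  unfold GG
  refine (Continuous.norm ?_).pow 2
  exact continuous_finsetSum _ fun j _ => continuous_ee.comp (by fun_prop)

lemma GG_integral (E : Set (ℝ × ℝ)) (hE : IsCompact E) (q k : ℕ) :
    ∫ z in E ×ˢ E, GG q k (z.1.2 - z.2.2) ≤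
      k * (volume.real E ^ 2 + 2 * ∑ l ∈ Finset.Ico 1 k, eh E (2 * (q * l : ℕ))) := by
  have hEE : IsCompact (E ×ˢ E) := hE.prod hE
  set f : ℤ → ℝ := fun l => eh E (2 * (q * l)) with hf
  have h1 : ∫ z in E ×ˢ E, GG q k (z.1.2 - z.2.2) =
      ∑ i ∈ Finset.range k, ∑ j ∈ Finset.range k, f (i - j) := by
    apply Complex.ofReal_injective
    rw [← integral_complex_ofReal]
    have e : ∀ z : (ℝ × ℝ) × (ℝ × ℝ), ((GG q k (z.1.2 - z.2.2) : ℝ) : ℂ) =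
        ∑ i ∈ Finset.range k, ∑ j ∈ Finset.range k,
          ee ((2 * (q * (i - j)) : ℤ) * z.1.2) * (starRingEnd ℂ) (ee ((2 * (q * (i - j)) : ℤ) * z.2.2)) := by
      intro z
      unfold GG
      push_cast
      rw [← Complex.mul_conj', map_sum, Finset.sum_mul_sum]
      refine Finset.sum_congr rfl fun i _ => Finset.sum_congr rfl fun j _ => ?_
      rw [conj_ee, conj_ee, ← ee_add, ← ee_add]; congr 1; ring
    simp_rw [e]
    have hc : ∀ i j : ℕ, Continuous fun z : (ℝ × ℝ) × (ℝ × ℝ) =>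
        ee ((2 * (q * (i - j)) : ℤ) * z.1.2) * (starRingEnd ℂ) (ee ((2 * (q * (i - j)) : ℤ) * z.2.2)) := by
      intro i j
      refine (continuous_ee.comp ?_).mul (Complex.continuous_conj.comp (continuous_ee.comp ?_)) <;> fun_prop
    rw [integral_finsetSum _ (fun i _ => (continuous_finsetSum _ fun j _ => hc i j).continuousOn.integrableOn_compact hEE),
      Complex.ofReal_sum]
    refine Finset.sum_congr rfl fun i _ => ?_
    rw [integral_finsetSum _ (fun j _ => (hc i j).continuousOn.integrableOn_compact hEE),
      Complex.ofReal_sum]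
    refine Finset.sum_congr rfl fun j _ => ?_
    rw [prod_herm E (fun α => ee ((2 * (q * (i - j)) : ℤ) * α.2))]
    rfl
  rw [h1]
  refine (toeplitz_sum f (fun l => eh_nonneg _ _) (fun l => ?_) k).trans ?_
  · rw [hf]; dsimp only; rw [← eh_neg]; congr 1; ring
  · gcongr with l hl
    · exact eh_le E hE _
    · rw [hf]; push_cast; exact le_rfl

lemma sum_dQ (h : ℕ → ℝ) (hh : ∀ m, 0 ≤ h m) (Q X k : ℕ) :
    ∑ q ∈ Finset.Icc 1 Q, (if q * k ≤ X then ∑ l ∈ Finset.Ico 1 k, h (q * l) else 0) ≤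
      ∑ m ∈ Finset.Icc 1 X, (dQ Q m : ℝ) * h m := by
  have h1 : ∑ m ∈ Finset.Icc 1 X, (dQ Q m : ℝ) * h m =
      ∑ q ∈ Finset.Icc 1 Q, ∑ m ∈ Finset.Icc 1 X, if q ∣ m then h m else 0 := by
    rw [Finset.sum_comm]
    refine Finset.sum_congr rfl fun m _ => ?_
    rw [dQ, ← Finset.sum_filter, Finset.sum_const, nsmul_eq_mul]
  rw [h1]
  refine Finset.sum_le_sum fun q hq => ?_
  rw [Finset.mem_Icc] at hq
  split_ifs with hk
  · rw [← Finset.sum_filter]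
    have e : ∑ l ∈ Finset.Ico 1 k, h (q * l) = ∑ m ∈ (Finset.Ico 1 k).image (fun l => q * l), h m := by
      rw [Finset.sum_image]
      intro a _ b _ hab
      exact Nat.eq_of_mul_eq_mul_left (by omega) hab
    rw [e]
    refine Finset.sum_le_sum_of_subset_of_nonneg ?_ (fun l _ _ => hh l)
    intro m hm
    rw [Finset.mem_image] at hm
    obtain ⟨l, hl, rfl⟩ := hm
    rw [Finset.mem_Ico] at hl
    rw [Finset.mem_filter, Finset.mem_Icc]
    refine ⟨⟨Nat.mul_pos (by omega) (by omega), ?_⟩, dvd_mul_right _ _⟩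
    exact (Nat.mul_le_mul_left q hl.2.le).trans hk
  · refine Finset.sum_nonneg fun m _ => ?_
    split_ifs
    · exact hh m
    · exact le_rfl

lemma int_affine {X : Type*} [MeasurableSpace X] (μ : Measure X) (S : Set X) (hS : μ S < ⊤)
    (f : X → ℝ) (hf : IntegrableOn f S μ) (a b : ℝ) :
    ∫ x in S, (a + b * f x) ∂μ = μ.real S * a + b * ∫ x in S, f x ∂μ := by
  have h1 : Integrable (fun _ : X => a) (μ.restrict S) := integrableOn_const hS.ne
  have h2 : Integrable (fun x => b * f x) (μ.restrict S) := hf.const_mul b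
  rw [integral_add h1 h2, integral_const_mul, setIntegral_const]
  rfl

lemma bessel (N Y X : ℕ) (g : ℕ → ℂ) (hN : 0 < N) (hY : 0 < Y) (hg : ∀ n, ‖g n‖ ≤ 1) (E : Set (ℝ × ℝ))
    (hE : IsCompact E) (hEu : E ⊆ usq) (hEc : ∀ α ∈ E, (N:ℝ) / Y ≤ ‖VV N g α‖) :
    ∑ m ∈ Finset.Icc 1 X, eh E (2 * m) ≤ volume.real E * (Y:ℝ) ^ 2 / N := by
  have hNr : (0:ℝ) < N := by exact_mod_cast hN
  have hYr : (0:ℝ) < Y := by exact_mod_cast hY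
  have hEm : MeasurableSet E := hE.measurableSet
  set a : ℕ → ℂ := fun m => (starRingEnd ℂ) (∫ α in E, ee ((2 * m : ℤ) * α.2)) with ha
  have hna : ∀ m, ‖a m‖ ^ 2 = eh E (2 * m) := by
    intro m; rw [ha, eh]; simp only [RCLike.norm_conj]
  set S := ∑ m ∈ Finset.Icc 1 X, eh E (2 * m) with hS
  have hS0 : 0 ≤ S := Finset.sum_nonneg fun m _ => eh_nonneg _ _
  set P : ℝ × ℝ → ℂ := fun α => ∑ m ∈ Finset.Icc 1 X, a m * ee ((2 * m : ℤ) * α.2) with hP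
  have hcm : ∀ m : ℕ, Continuous fun α : ℝ × ℝ => a m * ee ((2 * m : ℤ) * α.2) := fun m =>
    continuous_const.mul (continuous_ee.comp (by fun_prop))
  have hPc : Continuous P := continuous_finsetSum _ fun m _ => hcm m
  have h1 : ((S:ℝ):ℂ) = ∫ α in E, P α := by
    rw [hP, integral_finsetSum _ (fun m _ => (hcm m).continuousOn.integrableOn_compact hE), hS,
      Complex.ofReal_sum]
    refine Finset.sum_congr rfl fun m _ => ?_
    rw [integral_const_mul, ha, Complex.conj_mul', eh]
    push_cast; rfl
  have h2 : S ≤ ∫ α in E, ‖P α‖ := by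
    have : ‖((S:ℝ):ℂ)‖ = S := by rw [Complex.norm_real, Real.norm_eq_abs, abs_of_nonneg hS0]
    rw [← this, h1]; exact norm_integral_le_integral_norm _
  set c : ℝ := (Y:ℝ) ^ 2 / N with hc
  have hcp : 0 < c := by positivity
  have h3 : ∀ α ∈ E, ‖P α‖ ≤ c / 2 + (1 / (2 * N)) * ‖VV N g α * P α‖ ^ 2 := by
    intro α hα
    have e1 := hEc α hα
    have e2 : (N:ℝ) / Y * ‖P α‖ ≤ ‖VV N g α * P α‖ := by
      rw [norm_mul]; gcongr
    have e3 : ((N:ℝ) / Y * ‖P α‖) ^ 2 ≤ ‖VV N g α * P α‖ ^ 2 := by gcongr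
    have e4 : ‖P α‖ ≤ c / 2 + (1 / (2 * N)) * ((N:ℝ) / Y * ‖P α‖) ^ 2 := by
      have : c / 2 + (1 / (2 * N)) * ((N:ℝ) / Y * ‖P α‖) ^ 2 - ‖P α‖ =
          (1 / (2 * c)) * (c - ‖P α‖) ^ 2 := by
        rw [hc]; field_simp; ring
      have h0 : 0 ≤ (1 / (2 * c)) * (c - ‖P α‖) ^ 2 := by positivity
      linarith
    refine e4.trans ?_
    gcongr
  have hVPc : Continuous fun α => ‖VV N g α * P α‖ ^ 2 := (((continuous_VV N g).mul hPc).norm).pow 2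
  have h4 : ∫ α in E, ‖VV N g α * P α‖ ^ 2 ≤ N * S := by
    have e1 : ∫ α in E, ‖VV N g α * P α‖ ^ 2 ≤ ∫ α in usq, ‖VV N g α * P α‖ ^ 2 := by
      refine setIntegral_mono_set (intOn_usq hVPc) ?_ ?_
      · exact Filter.Eventually.of_forall fun α => by positivity
      · exact Filter.Eventually.of_forall hEu
    refine e1.trans ?_
    have e2 : ∀ α : ℝ × ℝ, VV N g α * P α = ∑ i ∈ Finset.Icc 1 N ×ˢ Finset.Icc 1 X,
        (g i.1 * a i.2) * ee ((i.1 : ℤ) * α.1 + ((i.1:ℤ) ^ 2 + 2 * i.2 : ℤ) * α.2) := by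
      intro α
      rw [VV, hP, Finset.sum_mul_sum, Finset.sum_product]
      refine Finset.sum_congr rfl fun n _ => Finset.sum_congr rfl fun m _ => ?_
      have : (((n : ℤ):ℝ) * α.1 + ((n:ℤ) ^ 2 + 2 * m : ℤ) * α.2) =
        (n * α.1 + (n:ℝ) ^ 2 * α.2) + ((2 * m : ℤ) * α.2) := by push_cast; ring
      rw [this, ee_add (n * α.1 + (n:ℝ) ^ 2 * α.2)]; ring
    simp_rw [e2]
    rw [parseval_inj _ (fun i : ℕ × ℕ => g i.1 * a i.2) (fun i => (i.1 : ℤ))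
      (fun i => (i.1:ℤ) ^ 2 + 2 * i.2), Finset.sum_product]
    · calc ∑ n ∈ Finset.Icc 1 N, ∑ m ∈ Finset.Icc 1 X, ‖g n * a m‖ ^ 2
          ≤ ∑ n ∈ Finset.Icc 1 N, ∑ m ∈ Finset.Icc 1 X, eh E (2 * m) := by
            refine Finset.sum_le_sum fun n _ => Finset.sum_le_sum fun m _ => ?_
            rw [norm_mul, mul_pow, ← hna]
            exact mul_le_of_le_one_left (by positivity) (pow_le_one₀ (norm_nonneg _) (hg n))
        _ = N * S := by simp [hS]
    · rintro ⟨n, m⟩ _ ⟨n', m'⟩ _ h h'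
      simp only [Nat.cast_inj] at h
      subst h
      simp only [Prod.mk.injEq, true_and]
      dsimp only at h'
      omega
  have h5 : ∫ α in E, ‖P α‖ ≤ ∫ α in E, (c / 2 + (1 / (2 * N)) * ‖VV N g α * P α‖ ^ 2) := by
    refine setIntegral_mono_on ?_ ?_ hEm h3
    · exact hPc.norm.continuousOn.integrableOn_compact hE
    · exact (continuous_const.add (continuous_const.mul hVPc)).continuousOn.integrableOn_compact hE
  rw [int_affine volume E hE.measure_lt_top _ (hVPc.continuousOn.integrableOn_compact hE)] at h5
  have h7 : (1 / (2 * (N:ℝ))) * ∫ α in E, ‖VV N g α * P α‖ ^ 2 ≤ S / 2 := by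
    calc _ ≤ (1 / (2 * (N:ℝ))) * (N * S) := by gcongr
      _ = _ := by field_simp
  have h8 : S ≤ volume.real E * c := by linarith
  rw [mul_div_assoc]; exact h8

lemma large_key (N Y : ℕ) (g : ℕ → ℂ) (hN : 4 ≤ N) (hY : 0 < Y) (hQN : 16 * Y ^ 4 ≤ N ^ 2)
    (hrem : N + 24 * N * (1 + Real.log (2 * N)) ≤ (N:ℝ) ^ 2 / (4 * Y ^ 4))
    (hg : ∀ n, ‖g n‖ ≤ 1) (E : Set (ℝ × ℝ))
    (hE : IsCompact E) (hEc : ∀ α ∈ E, (N:ℝ) / Y ≤ ‖VV N g α‖) :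
    (N:ℝ) ^ 2 * volume.real E ^ 2 ≤ 512 * LL Y * (II N Y).card * Y ^ 4 *
      (16 * Y ^ 4 * volume.real E ^ 2 + 2 * ∑ m ∈ Finset.Icc 1 (N ^ 2), dQ (16 * Y ^ 4) m * eh E (2 * m)) := by
  have hNr : (0:ℝ) < N := by exact_mod_cast (show 0 < N by omega)
  have hYr : (0:ℝ) < Y := by exact_mod_cast hY
  have hEE : IsCompact (E ×ˢ E) := hE.prod hE
  have hEEm : MeasurableSet (E ×ˢ E) := hEE.measurableSet
  set v := volume.real E with hv
  have hv0 : 0 ≤ v := measureReal_nonneg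
  have hL0 : 0 ≤ LL Y := by
    unfold LL
    have : 0 ≤ Real.log (1 + 1024 * (Y:ℝ) ^ 8) := Real.log_nonneg (by
      have : (0:ℝ) ≤ 1024 * (Y:ℝ) ^ 8 := by positivity
      linarith)
    linarith
  have h1 := dual_step N g hg E hE ((N:ℝ) / Y) (by positivity) hEc
  set W : ℝ → ℝ := fun t => ∑ q ∈ Finset.Icc 1 (16 * Y ^ 4), ∑ i ∈ II N Y,
        if q * 2 ^ i ≤ N ^ 2 then GG q (2 ^ i) t / 2 ^ i else 0 with hW
  set R := ∑ m ∈ Finset.Icc 1 (N ^ 2), (dQ (16 * Y ^ 4) m : ℝ) * eh E (2 * m) with hR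
  have htc : ∀ q i : ℕ, Continuous fun t : ℝ => if q * 2 ^ i ≤ N ^ 2 then GG q (2 ^ i) t / 2 ^ i else 0 := by
    intro q i
    split_ifs
    · exact (continuous_GG q (2 ^ i)).div_const _
    · exact continuous_const
  have hWc : Continuous W := continuous_finsetSum _ fun q _ => continuous_finsetSum _ fun i _ => htc q i
  have hsub : Continuous fun z : (ℝ × ℝ) × (ℝ × ℝ) => z.1.2 - z.2.2 := by fun_prop
  have h2 : ∫ z in E ×ˢ E, ‖VV N (fun _ => 1) (z.1 - z.2)‖ ≤
      ∫ z in E ×ˢ E, (3 * N / (4 * Y ^ 2) + (128 * LL Y * Y ^ 2 / N) * W (z.1.2 - z.2.2)) := by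
    refine setIntegral_mono_on ?_ ?_ hEEm ?_
    · exact (((continuous_VV N _).comp (continuous_fst.sub continuous_snd)).norm).continuousOn.integrableOn_compact hEE
    · exact (continuous_const.add (continuous_const.mul (hWc.comp hsub))).continuousOn.integrableOn_compact hEE
    · intro z _
      have e1 := weyl_pointwise N Y hN hY hQN hrem (z.1.1 - z.2.1) (z.1.2 - z.2.2)
      have e0 : z.1 - z.2 = (z.1.1 - z.2.1, z.1.2 - z.2.2) := rfl
      rw [e0]
      set k := ‖VV N (fun _ => 1) (z.1.1 - z.2.1, z.1.2 - z.2.2)‖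
      have e2 : k ≤ N / (2 * Y ^ 2) + (Y ^ 2 / (2 * N)) * k ^ 2 := by
        have : N / (2 * (Y:ℝ) ^ 2) + (Y ^ 2 / (2 * N)) * k ^ 2 - k =
            (Y:ℝ) ^ 2 / (2 * N) * (N / Y ^ 2 - k) ^ 2 := by field_simp; ring
        have h0 : 0 ≤ (Y:ℝ) ^ 2 / (2 * N) * (N / Y ^ 2 - k) ^ 2 := by positivity
        linarith
      refine e2.trans ?_
      have e3 : (Y:ℝ) ^ 2 / (2 * N) * k ^ 2 ≤ (Y:ℝ) ^ 2 / (2 * N) *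
          ((N:ℝ) ^ 2 / (2 * Y ^ 4) + 256 * LL Y * W (z.1.2 - z.2.2)) := by
        gcongr
      refine (add_le_add le_rfl e3).trans (le_of_eq ?_)
      field_simp; ring
  have h3 : ∫ z in E ×ˢ E, W (z.1.2 - z.2.2) ≤ (II N Y).card * (16 * Y ^ 4 * v ^ 2 + 2 * R) := by
    have hti : ∀ q i : ℕ, IntegrableOn (fun z : (ℝ × ℝ) × (ℝ × ℝ) =>
        if q * 2 ^ i ≤ N ^ 2 then GG q (2 ^ i) (z.1.2 - z.2.2) / 2 ^ i else 0) (E ×ˢ E) := fun q i =>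
      ((htc q i).comp hsub).continuousOn.integrableOn_compact hEE
    have e1 : ∫ z in E ×ˢ E, W (z.1.2 - z.2.2) = ∑ i ∈ II N Y, ∑ q ∈ Finset.Icc 1 (16 * Y ^ 4),
        ∫ z in E ×ˢ E, (if q * 2 ^ i ≤ N ^ 2 then GG q (2 ^ i) (z.1.2 - z.2.2) / 2 ^ i else 0) := by
      rw [Finset.sum_comm, hW]
      simp only
      rw [integral_finsetSum _ (fun q _ => integrable_finsetSum _ fun i _ => hti q i)]
      refine Finset.sum_congr rfl fun q _ => ?_
      rw [integral_finsetSum _ (fun i _ => hti q i)]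
    rw [e1, ← nsmul_eq_mul]
    refine Finset.sum_le_card_nsmul _ _ _ fun i _ => ?_
    have e2 : ∀ q ∈ Finset.Icc 1 (16 * Y ^ 4), ∫ z in E ×ˢ E, (if q * 2 ^ i ≤ N ^ 2 then
        GG q (2 ^ i) (z.1.2 - z.2.2) / 2 ^ i else 0) ≤ v ^ 2 + 2 *
        (if q * 2 ^ i ≤ N ^ 2 then ∑ l ∈ Finset.Ico 1 (2 ^ i), eh E (2 * (q * l : ℕ)) else 0) := by
      intro q _
      split_ifs
      · rw [integral_div, div_le_iff₀ (by positivity), mul_comm]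
        have := GG_integral E hE q (2 ^ i)
        push_cast at this ⊢
        exact this
      · simp; positivity
    refine (Finset.sum_le_sum e2).trans ?_
    rw [Finset.sum_add_distrib, ← Finset.mul_sum]
    have e3 := sum_dQ (fun m => eh E (2 * m)) (fun m => eh_nonneg _ _) (16 * Y ^ 4) (N ^ 2) (2 ^ i)
    have e4 : ∑ q ∈ Finset.Icc 1 (16 * Y ^ 4), v ^ 2 = 16 * (Y:ℝ) ^ 4 * v ^ 2 := by simp
    rw [e4]
    gcongr
  rw [int_affine volume (E ×ˢ E) hEE.measure_lt_top (fun z => W (z.1.2 - z.2.2))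
    ((hWc.comp hsub).continuousOn.integrableOn_compact hEE), vol_prod_E] at h2
  set Z := (II N Y).card * (16 * (Y:ℝ) ^ 4 * v ^ 2 + 2 * R) with hZ
  have h7 : ((N:ℝ) / Y * v) ^ 2 ≤ N * (v ^ 2 * (3 * N / (4 * Y ^ 2)) + 128 * LL Y * Y ^ 2 / N * Z) := by
    refine h1.trans ?_
    gcongr
    refine h2.trans ?_
    gcongr
  have h8 : ((N:ℝ) / Y * v) ^ 2 = N ^ 2 * v ^ 2 / Y ^ 2 := by field_simp
  have h9 : N * (v ^ 2 * (3 * (N:ℝ) / (4 * Y ^ 2)) + 128 * LL Y * Y ^ 2 / N * Z) =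
      (3 / 4) * (N ^ 2 * v ^ 2 / Y ^ 2) + 128 * LL Y * Y ^ 2 * Z := by field_simp
  rw [h8, h9] at h7
  have h10 : (N:ℝ) ^ 2 * v ^ 2 / Y ^ 2 ≤ 512 * LL Y * Y ^ 2 * Z := by linarith
  rw [div_le_iff₀ (by positivity)] at h10
  refine h10.trans (le_of_eq ?_)
  rw [hZ]; ring

lemma LT_bound (η : ℝ) (hη : 0 < η) : ∃ C : ℝ, 0 < C ∧ ∀ Y : ℕ, 0 < Y →
    LL Y * ((Nat.log 2 (2 ^ 18 * Y ^ 12) : ℝ) + 1) ≤ C * (Y:ℝ) ^ η := by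
  have hl0 : 0 ≤ Real.log 1025 := Real.log_nonneg (by norm_num)
  refine ⟨(1 + Real.log 1025 + 8 / (η / 2)) * (19 + 24 / (η / 2)), by positivity, fun Y hY => ?_⟩
  have hYr : (1:ℝ) ≤ Y := by exact_mod_cast hY
  have hlog0 : 0 ≤ Real.log Y := Real.log_nonneg hYr
  have hlog : Real.log Y ≤ (Y:ℝ) ^ (η / 2) / (η / 2) :=
    Real.log_le_rpow_div (by positivity) (by positivity)
  set y := (Y:ℝ) ^ (η / 2) with hy
  have hy1 : 1 ≤ y := Real.one_le_rpow hYr (by positivity)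
  have hyy : (Y:ℝ) ^ η = y * y := by
    rw [hy, ← Real.rpow_add (by positivity)]; congr 1; ring
  have h1 : LL Y ≤ (1 + Real.log 1025 + 8 / (η / 2)) * y := by
    unfold LL
    have e1 : Real.log (1 + 1024 * (Y:ℝ) ^ 8) ≤ Real.log (1025 * (Y:ℝ) ^ 8) := by
      apply Real.log_le_log (by positivity)
      have : (1:ℝ) ≤ (Y:ℝ) ^ 8 := one_le_pow₀ hYr
      linarith
    rw [Real.log_mul (by norm_num) (by positivity), Real.log_pow] at e1
    push_cast at e1
    have e2 : (1 + Real.log 1025) * 1 ≤ (1 + Real.log 1025) * y := by gcongr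
    have e3 : 8 * Real.log Y ≤ 8 / (η / 2) * y := by
      calc 8 * Real.log Y ≤ 8 * (y / (η / 2)) := by gcongr
        _ = _ := by ring
    linarith
  have h2 : (Nat.log 2 (2 ^ 18 * Y ^ 12) : ℝ) + 1 ≤ (19 + 24 / (η / 2)) * y := by
    have e1 := Real.natLog_le_logb (2 ^ 18 * Y ^ 12) 2
    have e2 : Real.logb (2:ℕ) ((2 ^ 18 * Y ^ 12 : ℕ) : ℝ) = 18 + 12 * (Real.log Y / Real.log 2) := by
      push_cast
      rw [Real.logb, Real.log_mul (by positivity) (by positivity), Real.log_pow,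
        show (262144:ℝ) = 2 ^ 18 by norm_num, Real.log_pow]
      have : Real.log 2 ≠ 0 := (Real.log_pos (by norm_num)).ne'
      push_cast
      field_simp
    rw [e2] at e1
    have e3 : Real.log Y / Real.log 2 ≤ 2 * Real.log Y := by
      rw [div_le_iff₀ (Real.log_pos (by norm_num))]
      nlinarith [Real.log_two_gt_d9]
    have e4 : 24 * Real.log Y ≤ 24 / (η / 2) * y := by
      calc 24 * Real.log Y ≤ 24 * (y / (η / 2)) := by gcongr
        _ = _ := by ring
    linarith
  have h3 : (0:ℝ) ≤ (Nat.log 2 (2 ^ 18 * Y ^ 12) : ℝ) + 1 := by positivity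
  calc LL Y * ((Nat.log 2 (2 ^ 18 * Y ^ 12) : ℝ) + 1)
      ≤ ((1 + Real.log 1025 + 8 / (η / 2)) * y) * ((19 + 24 / (η / 2)) * y) :=
        mul_le_mul h1 h2 h3 (by positivity)
    _ = _ := by rw [hyy]; ring

lemma trunc_sum (s : Finset ℕ) (d h : ℕ → ℝ) (hd : ∀ m, 0 ≤ d m) (V D : ℝ) (hD : 0 < D) (b : ℕ)
    (h0 : ∀ m, 0 ≤ h m) (hV : ∀ m, h m ≤ V) :
    ∑ m ∈ s, d m * h m ≤ D * ∑ m ∈ s, h m + V / D ^ b * ∑ m ∈ s, d m ^ (b + 1) := by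
  rw [Finset.mul_sum, Finset.mul_sum, ← Finset.sum_add_distrib]
  refine Finset.sum_le_sum fun m _ => ?_
  have hd := hd m
  have h0 := h0 m
  have hV := hV m
  have hV0 : 0 ≤ V := h0.trans hV
  rcases le_total (d m) D with hle | hle
  · have : 0 ≤ V / D ^ b * d m ^ (b + 1) := by positivity
    have : d m * h m ≤ D * h m := by gcongr
    linarith
  · have e1 : D ^ b ≤ d m ^ b := by gcongr
    have e2 : d m * h m ≤ V / D ^ b * d m ^ (b + 1) := by
      rw [div_mul_eq_mul_div, le_div_iff₀ (by positivity)]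
      calc d m * h m * D ^ b ≤ d m * V * d m ^ b := by gcongr
        _ = _ := by ring
    have : 0 ≤ D * h m := by positivity
    linarith

lemma rem_bound (N Y : ℕ) (hY : 0 < Y) (h : 150544 * (Y:ℝ) ^ 8 ≤ N) :
    N + 24 * N * (1 + Real.log (2 * N)) ≤ (N:ℝ) ^ 2 / (4 * Y ^ 4) := by
  have hYr : (1:ℝ) ≤ Y := by exact_mod_cast hY
  have h8 : (1:ℝ) ≤ (Y:ℝ) ^ 8 := one_le_pow₀ hYr
  have hN : (1:ℝ) ≤ N := by linarith
  set s := √(N:ℝ) with hs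
  have hss : s ^ 2 = N := Real.sq_sqrt (by linarith)
  have hs1 : 1 ≤ s := by rw [hs, Real.one_le_sqrt]; exact hN
  have hlog : Real.log (2 * N) ≤ 3 * s := by
    have e1 : Real.log (2 * N) = Real.log 2 + 2 * Real.log s := by
      rw [Real.log_mul (by norm_num) (by linarith), ← hss, Real.log_pow]; push_cast; ring
    have e2 := Real.log_le_sub_one_of_pos (show 0 < s by linarith)
    have e3 := Real.log_two_lt_d9
    linarith
  have hY4 : 388 * (Y:ℝ) ^ 4 ≤ s := by
    apply Real.le_sqrt_of_sq_le
    nlinarith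
  rw [le_div_iff₀ (by positivity)]
  have e1 : N + 24 * N * (1 + Real.log (2 * N)) ≤ N * (97 * s) := by
    have : 1 + 24 * (1 + Real.log (2 * N)) ≤ 97 * s := by linarith
    calc N + 24 * N * (1 + Real.log (2 * N)) = N * (1 + 24 * (1 + Real.log (2 * N))) := by ring
      _ ≤ _ := by gcongr
  calc (N + 24 * N * (1 + Real.log (2 * N))) * (4 * (Y:ℝ) ^ 4) ≤ N * (97 * s) * (4 * (Y:ℝ) ^ 4) := by gcongr
    _ = N * (s * (388 * (Y:ℝ) ^ 4)) := by ring
    _ ≤ N * (s * s) := by gcongr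
    _ = N ^ 2 := by rw [← sq, hss]; ring

/-- level set -/
def EE (N Y : ℕ) (g : ℕ → ℂ) : Set (ℝ × ℝ) := {α | α ∈ usq ∧ (N:ℝ) / Y ≤ ‖VV N g α‖}

lemma isCompact_EE (N Y : ℕ) (g : ℕ → ℂ) : IsCompact (EE N Y g) := by
  have : EE N Y g = usq ∩ {α | (N:ℝ) / Y ≤ ‖VV N g α‖} := rfl
  rw [this]
  exact isCompact_usq.inter_right (isClosed_le continuous_const (continuous_VV N g).norm)

lemma large_values (κ : ℝ) (hκ : 0 < κ) : ∃ A C : ℝ, 1 ≤ A ∧ 0 < C ∧ ∀ (N Y : ℕ) (g : ℕ → ℂ),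
    0 < Y → A * (Y:ℝ) ^ 20 ≤ N → (∀ n, ‖g n‖ ≤ 1) →
    volume.real (EE N Y g) ≤ C * (Y:ℝ) ^ (6 + κ) / N ^ 3 := by
  obtain ⟨C₁, hC₁, hLT1⟩ := LT_bound (κ / 2) (by positivity)
  obtain ⟨C₂, hC₂, hLT2⟩ := LT_bound 1 (by norm_num)
  obtain ⟨b, hb⟩ := exists_nat_ge ((8 + κ / 2) / (κ / 2))
  rw [div_le_iff₀ (by positivity)] at hb
  have hb1 : 1 ≤ b := by
    by_contra h
    have : b = 0 := by omega
    rw [this] at hb; simp at hb; linarith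
  obtain ⟨CB, hCB, hdQ⟩ := dQ_moment (b + 1) (by omega)
  set A₁ := 65536 * CB * C₁ + 1 with hA₁
  have hA₁1 : 1 ≤ A₁ := by rw [hA₁]; linarith [show 0 < 65536 * CB * C₁ by positivity]
  refine ⟨150544 + 16384 * C₂, 4096 * C₁ * A₁, by linarith, by positivity, ?_⟩
  intro N Y g hY hA hg
  have hYr : (1:ℝ) ≤ Y := by exact_mod_cast hY
  have hY20 : (1:ℝ) ≤ (Y:ℝ) ^ 20 := one_le_pow₀ hYr
  have hpw : ∀ k ≤ 20, (Y:ℝ) ^ k ≤ (Y:ℝ) ^ 20 := fun k hk => pow_le_pow_right₀ hYr hk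
  have hCY : 0 ≤ 16384 * C₂ * (Y:ℝ) ^ 20 := by positivity
  have hA' : 150544 * (Y:ℝ) ^ 20 + 16384 * C₂ * (Y:ℝ) ^ 20 ≤ N := by linarith
  have hNr : (150544:ℝ) ≤ N := by linarith
  have hN0 : (0:ℝ) < N := by linarith
  have hN4 : 4 ≤ N := by
    have : (4:ℝ) ≤ N := by linarith
    exact_mod_cast this
  have hNN : (N:ℝ) ≤ N ^ 2 := by nlinarith
  have hQN : 16 * Y ^ 4 ≤ N ^ 2 := by
    have : 16 * (Y:ℝ) ^ 4 ≤ N ^ 2 := by linarith [hpw 4 (by norm_num)]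
    exact_mod_cast this
  have hrem := rem_bound N Y hY (by linarith [hpw 8 (by norm_num)])
  set E := EE N Y g with hEdef
  have hE : IsCompact E := isCompact_EE N Y g
  have hEu : E ⊆ usq := fun α h => h.1
  have hEc : ∀ α ∈ E, (N:ℝ) / Y ≤ ‖VV N g α‖ := fun α h => h.2
  have hkey := large_key N Y g hN4 hY hQN hrem hg E hE hEc
  have hbes := bessel N Y (N ^ 2) g (by omega) hY hg E hE hEu hEc
  set v := volume.real E with hv
  have hv0 : 0 ≤ v := measureReal_nonneg
  set τ := LL Y * (II N Y).card with hτ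
  have hL0 : 0 ≤ LL Y := by
    unfold LL
    have : 0 ≤ Real.log (1 + 1024 * (Y:ℝ) ^ 8) := Real.log_nonneg (by
      have : (0:ℝ) ≤ 1024 * (Y:ℝ) ^ 8 := by positivity
      linarith)
    linarith
  have hτ0 : 0 ≤ τ := by positivity
  have hcard : ((II N Y).card : ℝ) ≤ (Nat.log 2 (2 ^ 18 * Y ^ 12) : ℝ) + 1 := by
    exact_mod_cast II_card N Y hY
  set y := (Y:ℝ) ^ (κ / 2) with hy
  have hy1 : 1 ≤ y := Real.one_le_rpow hYr (by positivity)
  have hτ1 : τ ≤ C₁ * y := (mul_le_mul_of_nonneg_left hcard hL0).trans (hLT1 Y hY)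
  have hτ2 : τ ≤ C₂ * Y := by
    have := (mul_le_mul_of_nonneg_left hcard hL0).trans (hLT2 Y hY)
    rwa [Real.rpow_one] at this
  set R := ∑ m ∈ Finset.Icc 1 (N ^ 2), (dQ (16 * Y ^ 4) m : ℝ) * eh E (2 * m) with hR
  have k1 : (N:ℝ) ^ 2 * v ^ 2 ≤ 2048 * τ * Y ^ 4 * R := by
    have e1 : 512 * LL Y * (II N Y).card * (Y:ℝ) ^ 4 * (16 * Y ^ 4 * v ^ 2 + 2 * R) =
        8192 * (τ * Y ^ 8) * v ^ 2 + 1024 * τ * Y ^ 4 * R := by rw [hτ]; ring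
    rw [e1] at hkey
    have e2 : 8192 * (τ * (Y:ℝ) ^ 8) ≤ N ^ 2 / 2 := by
      have : τ * (Y:ℝ) ^ 8 ≤ C₂ * (Y:ℝ) ^ 20 := by
        calc τ * (Y:ℝ) ^ 8 ≤ C₂ * Y * (Y:ℝ) ^ 8 := by gcongr
          _ = C₂ * (Y:ℝ) ^ 9 := by ring
          _ ≤ _ := by gcongr; norm_num
      linarith
    have e3 : 8192 * (τ * (Y:ℝ) ^ 8) * v ^ 2 ≤ N ^ 2 / 2 * v ^ 2 := by gcongr
    linarith
  set D := A₁ * y with hD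
  have hDp : 0 < D := by positivity
  have k2 : R ≤ D * (v * (Y:ℝ) ^ 2 / N) + v ^ 2 / D ^ b * (CB * (16 * Y ^ 4) * N ^ 2) := by
    refine (trunc_sum _ (fun m => (dQ (16 * Y ^ 4) m : ℝ)) (fun m => eh E (2 * m)) (fun m => by positivity)
      (v ^ 2) D hDp b (fun m => eh_nonneg _ _) (fun m => eh_le E hE _)).trans ?_
    have := hdQ (16 * Y ^ 4) (N ^ 2) (by positivity)
    push_cast at this
    gcongr
  have k3 : 65536 * C₁ * CB * y * (Y:ℝ) ^ 8 ≤ D ^ b := by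
    have e1 : D ^ b = A₁ ^ b * y ^ b := mul_pow _ _ _
    have e2 : A₁ ≤ A₁ ^ b := le_self_pow₀ hA₁1 (by omega)
    have e3 : y * (Y:ℝ) ^ 8 ≤ y ^ b := by
      rw [hy, ← Real.rpow_natCast, ← Real.rpow_natCast, ← Real.rpow_mul (by positivity),
        ← Real.rpow_add (by positivity)]
      apply Real.rpow_le_rpow_of_exponent_le hYr
      push_cast; linarith
    rw [e1]
    calc 65536 * C₁ * CB * y * (Y:ℝ) ^ 8 = (65536 * CB * C₁) * (y * (Y:ℝ) ^ 8) := by ring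
      _ ≤ A₁ * (y * (Y:ℝ) ^ 8) := by gcongr; rw [hA₁]; linarith
      _ ≤ A₁ ^ b * y ^ b := by gcongr
  have k4 : 2048 * τ * (Y:ℝ) ^ 4 * (v ^ 2 / D ^ b * (CB * (16 * Y ^ 4) * N ^ 2)) ≤ N ^ 2 * v ^ 2 / 2 := by
    have : 2048 * τ * (Y:ℝ) ^ 4 * (v ^ 2 / D ^ b * (CB * (16 * Y ^ 4) * N ^ 2)) =
        (32768 * τ * CB * (Y:ℝ) ^ 8) * (v ^ 2 * N ^ 2) / D ^ b := by ring
    rw [this, div_le_iff₀ (by positivity)]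
    calc (32768 * τ * CB * (Y:ℝ) ^ 8) * (v ^ 2 * N ^ 2)
        ≤ (32768 * (C₁ * y) * CB * (Y:ℝ) ^ 8) * (v ^ 2 * N ^ 2) := by gcongr
      _ = N ^ 2 * v ^ 2 / 2 * (65536 * C₁ * CB * y * (Y:ℝ) ^ 8) := by ring
      _ ≤ _ := by gcongr
  have k5 : 2048 * τ * (Y:ℝ) ^ 4 * R ≤ 2048 * τ * (Y:ℝ) ^ 4 * (D * (v * (Y:ℝ) ^ 2 / N) +
      v ^ 2 / D ^ b * (CB * (16 * Y ^ 4) * N ^ 2)) := by gcongr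
  have k6 : (N:ℝ) ^ 2 * v ^ 2 ≤ 4096 * τ * Y ^ 4 * (D * (v * (Y:ℝ) ^ 2 / N)) := by
    rw [mul_add] at k5
    linarith
  have k7 : 4096 * τ * Y ^ 4 * (D * (v * (Y:ℝ) ^ 2 / N)) ≤ 4096 * (C₁ * y) * Y ^ 4 * (D * (v * (Y:ℝ) ^ 2 / N)) := by
    gcongr
  have k8 : (Y:ℝ) ^ (6 + κ) = Y ^ 6 * (y * y) := by
    rw [hy, ← Real.rpow_add (by positivity), ← Real.rpow_natCast, ← Real.rpow_add (by positivity)]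
    congr 1; push_cast; ring
  rw [le_div_iff₀ (by positivity), k8]
  have k9 := k6.trans k7
  rcases hv0.eq_or_lt with h | h
  · rw [← h, zero_mul]; positivity
  · have e1 : 4096 * (C₁ * y) * Y ^ 4 * (D * (v * (Y:ℝ) ^ 2 / N)) =
        (4096 * C₁ * A₁ * (Y ^ 6 * (y * y))) * v / N := by rw [hD]; ring
    rw [e1, le_div_iff₀ hN0] at k9
    have e2 : v * (v * N ^ 3) ≤ v * (4096 * C₁ * A₁ * (Y ^ 6 * (y * y))) := by linarith
    exact le_of_mul_le_mul_left e2 h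

lemma dyadic_split (N x p : ℝ) (hN : 0 < N) (hx0 : 0 ≤ x) (hxN : x ≤ N) (hp : 6 < p) (I : ℕ) :
    x ≤ N / 2 ^ I ∨ x ^ p ≤ ∑ i ∈ Finset.range I, if N / 2 ^ (i + 1) ≤ x then (N / 2 ^ i) ^ p else 0 := by
  induction I with
  | zero => left; simpa using hxN
  | succ I ih =>
    rw [Finset.sum_range_succ]
    have hnn : ∀ i : ℕ, 0 ≤ if N / 2 ^ (i + 1) ≤ x then (N / 2 ^ i) ^ p else 0 := by
      intro i; split_ifs
      · positivity
      · exact le_rfl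
    rcases ih with h | h
    · by_cases h' : N / 2 ^ (I + 1) ≤ x
      · right
        rw [if_pos h']
        have e1 : x ^ p ≤ (N / 2 ^ I) ^ p := Real.rpow_le_rpow hx0 h (by linarith)
        have e2 := Finset.sum_nonneg (s := Finset.range I) fun i _ => hnn i
        linarith
      · left; exact (not_le.mp h').le
    · right; linarith [hnn I]

lemma moment_bound (p : ℝ) (hp : 6 < p) : ∃ C : ℝ, 0 < C ∧ ∀ (N : ℕ) (g : ℕ → ℂ), 0 < N →
    (∀ n, ‖g n‖ ≤ 1) → ∫ α in usq, ‖VV N g α‖ ^ p ≤ C * (N:ℝ) ^ (p - 3) := by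
  set κ := (p - 6) / 2 with hκd
  have hκ : 0 < κ := by rw [hκd]; linarith
  obtain ⟨A, C, hA, hC, hlv⟩ := large_values κ hκ
  obtain ⟨C6, hC6, h6⟩ := sixth_moment ((p - 6) / 20) (by linarith)
  set r : ℝ := 2 ^ (-κ) with hr
  have hr0 : 0 < r := by positivity
  have hr1 : r < 1 := Real.rpow_lt_one_of_one_lt_of_neg (by norm_num) (by linarith)
  refine ⟨(2 * A) ^ (p - 6) * C6 + C * 2 ^ (6 + κ) * (1 - r)⁻¹, ?_, ?_⟩
  · have : 0 < 1 - r := by linarith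
    positivity
  intro N g hN hg
  have hNr : (0:ℝ) < N := by exact_mod_cast hN
  have hN1 : (1:ℝ) ≤ N := by exact_mod_cast hN
  have hex : ∃ I : ℕ, (N:ℝ) < A * 2 ^ (20 * (I + 1)) := by
    refine ⟨N, ?_⟩
    have e1 : (N:ℝ) < 2 ^ N := by exact_mod_cast Nat.lt_two_pow_self
    have e2 : (2:ℝ) ^ N ≤ 2 ^ (20 * (N + 1)) := pow_le_pow_right₀ (by norm_num) (by omega)
    have e3 : (2:ℝ) ^ (20 * (N + 1)) ≤ A * 2 ^ (20 * (N + 1)) := le_mul_of_one_le_left (by positivity) hA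
    linarith
  obtain ⟨I, hI1, hI2⟩ : ∃ I : ℕ, (N:ℝ) < A * 2 ^ (20 * (I + 1)) ∧
      ∀ i < I, A * (2:ℝ) ^ (20 * (i + 1)) ≤ N := by
    classical
    exact ⟨Nat.find hex, Nat.find_spec hex, fun i hi => not_lt.mp (Nat.find_min hex hi)⟩
  set T : ℝ := N / 2 ^ I with hT
  have hT0 : 0 < T := by positivity
  have hVc := (continuous_VV N g).norm
  have hpt : ∀ α, ‖VV N g α‖ ^ p ≤ T ^ (p - 6) * ‖VV N g α‖ ^ 6 + ∑ i ∈ Finset.range I,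
      if (N:ℝ) / 2 ^ (i + 1) ≤ ‖VV N g α‖ then ((N:ℝ) / 2 ^ i) ^ p else 0 := by
    intro α
    have hx0 := norm_nonneg (VV N g α)
    rcases dyadic_split N ‖VV N g α‖ p hNr hx0 (norm_VV_le N g hg α) hp I with h | h
    · have e1 : ‖VV N g α‖ ^ p = ‖VV N g α‖ ^ (p - 6) * ‖VV N g α‖ ^ 6 := by
        rw [← Real.rpow_natCast, ← Real.rpow_add' hx0 (by push_cast; linarith)]
        congr 1; push_cast; ring
      have e2 : ‖VV N g α‖ ^ (p - 6) ≤ T ^ (p - 6) := Real.rpow_le_rpow hx0 h (by linarith)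
      have e3 : 0 ≤ ∑ i ∈ Finset.range I,
        if (N:ℝ) / 2 ^ (i + 1) ≤ ‖VV N g α‖ then ((N:ℝ) / 2 ^ i) ^ p else 0 := by
        refine Finset.sum_nonneg fun i _ => ?_
        split_ifs
        · positivity
        · exact le_rfl
      rw [e1]
      have : ‖VV N g α‖ ^ (p - 6) * ‖VV N g α‖ ^ 6 ≤ T ^ (p - 6) * ‖VV N g α‖ ^ 6 := by gcongr
      linarith
    · have : 0 ≤ T ^ (p - 6) * ‖VV N g α‖ ^ 6 := by positivity
      linarith
  have hind : ∀ i : ℕ, ∀ α ∈ usq, (if (N:ℝ) / 2 ^ (i + 1) ≤ ‖VV N g α‖ then ((N:ℝ) / 2 ^ i) ^ p else 0) =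
      (EE N (2 ^ (i + 1)) g).indicator (fun _ => ((N:ℝ) / 2 ^ i) ^ p) α := by
    intro i α hα
    by_cases h : (N:ℝ) / 2 ^ (i + 1) ≤ ‖VV N g α‖
    · rw [if_pos h, Set.indicator_of_mem]
      exact ⟨hα, by push_cast; exact h⟩
    · rw [if_neg h, Set.indicator_of_notMem]
      intro h2
      have := h2.2
      push_cast at this
      exact h this
  have hEm : ∀ i, MeasurableSet (EE N (2 ^ (i + 1)) g) := fun i => (isCompact_EE _ _ _).measurableSet
  have hiint : ∀ i : ℕ, IntegrableOn (fun α => (EE N (2 ^ (i + 1)) g).indicator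
      (fun _ => ((N:ℝ) / 2 ^ i) ^ p) α) usq := fun i =>
    (intOn_usq continuous_const).indicator (hEm i)
  have h6int : IntegrableOn (fun α => T ^ (p - 6) * ‖VV N g α‖ ^ 6) usq :=
    intOn_usq (continuous_const.mul (hVc.pow 6))
  have hsint : IntegrableOn (fun α => ∑ i ∈ Finset.range I, (EE N (2 ^ (i + 1)) g).indicator
      (fun _ => ((N:ℝ) / 2 ^ i) ^ p) α) usq := integrable_finsetSum _ fun i _ => hiint i
  have hm : ∫ α in usq, ‖VV N g α‖ ^ p ≤ ∫ α in usq, (T ^ (p - 6) * ‖VV N g α‖ ^ 6 +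
      ∑ i ∈ Finset.range I, (EE N (2 ^ (i + 1)) g).indicator (fun _ => ((N:ℝ) / 2 ^ i) ^ p) α) := by
    refine setIntegral_mono_on ?_ (h6int.add hsint) measurableSet_usq ?_
    · exact intOn_usq (hVc.rpow_const fun _ => Or.inr (by linarith))
    · intro α hα
      refine (hpt α).trans (le_of_eq ?_)
      congr 1
      exact Finset.sum_congr rfl fun i _ => hind i α hα
  rw [integral_add h6int hsint, integral_const_mul, integral_finsetSum _ fun i _ => hiint i] at hm
  have hterm : ∀ i ∈ Finset.range I, ∫ α in usq, (EE N (2 ^ (i + 1)) g).indicator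
      (fun _ => ((N:ℝ) / 2 ^ i) ^ p) α ≤ C * 2 ^ (6 + κ) * (N:ℝ) ^ (p - 3) * r ^ i := by
    intro i hi
    rw [Finset.mem_range] at hi
    rw [setIntegral_indicator (hEm i), Set.inter_eq_right.mpr (fun α h => h.1), setIntegral_const,
      smul_eq_mul]
    have e1 := hlv N (2 ^ (i + 1)) g (by positivity) (by
      have := hI2 i hi
      push_cast
      rw [← pow_mul, mul_comm (i + 1)]; exact this) hg
    calc volume.real (EE N (2 ^ (i + 1)) g) * ((N:ℝ) / 2 ^ i) ^ p
        ≤ (C * ((2 ^ (i + 1) : ℕ):ℝ) ^ (6 + κ) / N ^ 3) * ((N:ℝ) / 2 ^ i) ^ p := by gcongr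
      _ = _ := by
        set u : ℝ := 2 ^ i with hu
        have hu0 : 0 < u := by positivity
        have a1 : ((2 ^ (i + 1) : ℕ):ℝ) = 2 * u := by push_cast; rw [hu]; ring
        have a2 : r ^ i = u ^ (6 + κ) / u ^ p := by
          rw [← Real.rpow_sub hu0, hr, hu, ← Real.rpow_natCast, ← Real.rpow_natCast,
            ← Real.rpow_mul (by norm_num), ← Real.rpow_mul (by norm_num)]
          congr 1; rw [hκd]; ring
        have a3 : (N:ℝ) ^ (p - 3) = (N:ℝ) ^ p / N ^ 3 := by
          rw [Real.rpow_sub hNr, ← Real.rpow_natCast]; norm_num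
        rw [a1, a2, a3, Real.mul_rpow (by norm_num) hu0.le, Real.div_rpow hNr.le hu0.le]
        ring
  have hgeo : ∑ i ∈ Finset.range I, r ^ i ≤ (1 - r)⁻¹ := by
    rw [← tsum_geometric_of_lt_one hr0.le hr1]
    exact (summable_geometric_of_lt_one hr0.le hr1).sum_le_tsum _ fun i _ => by positivity
  have hs2 : ∑ i ∈ Finset.range I, ∫ α in usq, (EE N (2 ^ (i + 1)) g).indicator
      (fun _ => ((N:ℝ) / 2 ^ i) ^ p) α ≤ C * 2 ^ (6 + κ) * (1 - r)⁻¹ * (N:ℝ) ^ (p - 3) := by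
    refine (Finset.sum_le_sum hterm).trans ?_
    rw [← Finset.mul_sum]
    calc C * 2 ^ (6 + κ) * (N:ℝ) ^ (p - 3) * ∑ i ∈ Finset.range I, r ^ i
        ≤ C * 2 ^ (6 + κ) * (N:ℝ) ^ (p - 3) * (1 - r)⁻¹ := by gcongr
      _ = _ := by ring
  have hTb : T ≤ (2 * A) * (N:ℝ) ^ (19 / 20 : ℝ) := by
    have e1 : (N:ℝ) ≤ (2 ^ (I + 1) * A) ^ 20 := by
      refine hI1.le.trans ?_
      rw [mul_pow, ← pow_mul, mul_comm A, mul_comm 20]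
      gcongr
      exact le_self_pow₀ hA (by norm_num)
    have e2 : (N:ℝ) ^ (1 / 20 : ℝ) ≤ 2 ^ (I + 1) * A := by
      calc (N:ℝ) ^ (1 / 20 : ℝ) ≤ (((2:ℝ) ^ (I + 1) * A) ^ 20) ^ (1 / 20 : ℝ) :=
            Real.rpow_le_rpow hNr.le e1 (by norm_num)
        _ = 2 ^ (I + 1) * A := by
          rw [← Real.rpow_natCast, ← Real.rpow_mul (by positivity)]; norm_num
    have e3 : (N:ℝ) = (N:ℝ) ^ (1 / 20 : ℝ) * (N:ℝ) ^ (19 / 20 : ℝ) := by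
      rw [← Real.rpow_add hNr]; norm_num
    rw [hT, div_le_iff₀ (by positivity)]
    calc (N:ℝ) = (N:ℝ) ^ (1 / 20 : ℝ) * (N:ℝ) ^ (19 / 20 : ℝ) := e3
      _ ≤ (2 ^ (I + 1) * A) * (N:ℝ) ^ (19 / 20 : ℝ) := by gcongr
      _ = _ := by ring
  have hfirst : T ^ (p - 6) * ∫ α in usq, ‖VV N g α‖ ^ 6 ≤ (2 * A) ^ (p - 6) * C6 * (N:ℝ) ^ (p - 3) := by
    have hp6 : 0 ≤ p - 6 := by linarith
    calc T ^ (p - 6) * ∫ α in usq, ‖VV N g α‖ ^ 6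
        ≤ ((2 * A) * (N:ℝ) ^ (19 / 20 : ℝ)) ^ (p - 6) * (C6 * (N:ℝ) ^ (3 + (p - 6) / 20)) := by
          gcongr
          exact h6 N g hN hg
      _ = (2 * A) ^ (p - 6) * C6 * ((N:ℝ) ^ ((19 / 20 : ℝ) * (p - 6)) * (N:ℝ) ^ (3 + (p - 6) / 20)) := by
          rw [Real.mul_rpow (by positivity) (by positivity), ← Real.rpow_mul hNr.le]; ring
      _ = _ := by
          rw [← Real.rpow_add hNr]; congr 2; ring
  rw [add_mul]
  linarith

theorem stmt_15 (p : ℝ) (hp : 6 < p) :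
    ∃ C : ℝ, 0 < C ∧ ∀ (N : ℕ) (g : ℕ → ℂ), 0 < N → (∀ n, ‖g n‖ ≤ 1) →
      (∫ α in Set.Icc ((0:ℝ), (0:ℝ)) (1, 1),
        ‖∑ n ∈ Finset.Icc 1 N,
          g n * Complex.exp (2 * Real.pi * Complex.I *
            (α.2 * (n:ℝ) ^ 2 + α.1 * (n:ℝ)))‖ ^ p)
        ≤ C * (N : ℝ) ^ (p - 3) := by
  obtain ⟨C, hC, h⟩ := moment_bound p hp
  refine ⟨C, hC, fun N g hN hg => ?_⟩
  have e : ∀ α : ℝ × ℝ, VV N g α = ∑ n ∈ Finset.Icc 1 N,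
          g n * Complex.exp (2 * Real.pi * Complex.I *
            (α.2 * (n:ℝ) ^ 2 + α.1 * (n:ℝ))) := by
    intro α
    rw [VV]
    refine Finset.sum_congr rfl fun n _ => ?_
    rw [ee]
    congr 2
    push_cast
    ring
  have := h N g hN hg
  simp_rw [e] at this
  exact this
end
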